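/- arXiv:alg-geom/9704014 — 2 statements merged into one kernel-verified Lean document; each statement's English description precedes it below -/
import Mathlib

section
/- For every convex polytope P and every face F of P, g(P,F) = Σ_{F ≤ F′ ≤ P} (−1)^{dim P − dim F′} g(F′)·ḡ(P/F′), where the sum runs over all faces F′ of P containing F. -/
open Polynomial
open scoped Classical

noncomputable section

/-- `P ⊆ ℝ^d` is a (convex) polytope: the convex hull of a finite set of points. -/
def IsPolytope {d : ℕ} (P : Set (Fin d → ℝ)) : Prop :=
  ∃ S : Finset (Fin d → ℝ), P = convexHull ℝ (S : Set (Fin d → ℝ))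

/-- `F` is a face of `P`: the empty set, `P` itself, or the intersection of `P`
with a supporting hyperplane. -/
def IsFace {d : ℕ} (P F : Set (Fin d → ℝ)) : Prop :=
  F = ∅ ∨ F = P ∨ ∃ (f : (Fin d → ℝ) →ₗ[ℝ] ℝ) (c : ℝ),
    (∀ x ∈ P, f x ≤ c) ∧ F = {x ∈ P | f x = c}

/-- Affine dimension of a subset of `ℝ^d`, with `pdim ∅ = -1`. -/
def pdim {d : ℕ} (P : Set (Fin d → ℝ)) : ℤ :=
  if P = ∅ then -1 else (Module.finrank ℝ (affineSpan ℝ P).direction : ℤ)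

/-- The pair of functions `g`, `h` satisfies the defining recursion of the
`g`- and `h`-polynomials of polytopes. -/
def IsGH {d : ℕ} (g h : Set (Fin d → ℝ) → Polynomial ℤ) : Prop :=
  g ∅ = 1 ∧
  (∀ P : Set (Fin d → ℝ), IsPolytope P →
      h P = ∑ᶠ F ∈ {F : Set (Fin d → ℝ) | IsFace P F ∧ F ≠ P},
        (X - 1 : Polynomial ℤ) ^ (pdim P - pdim F - 1).toNat * g F) ∧
  (∀ P : Set (Fin d → ℝ), IsPolytope P → P ≠ ∅ →
      (g P).coeff 0 = (h P).coeff 0 ∧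
      (∀ i : ℕ, 0 < i → 2 * (i : ℤ) ≤ pdim P →
        (g P).coeff i = (h P).coeff i - (h P).coeff (i - 1)) ∧
      (∀ i : ℕ, 0 < i → ¬(2 * (i : ℤ) ≤ pdim P) → (g P).coeff i = 0))

/-- `Q` is (a combinatorial model of) the quotient polytope `P/E`, with `ψ` an
explicit isomorphism from the interval `[E, P]` in the face poset of `P` to the
face poset of `Q`. -/
def IsQuotientPair {d : ℕ} (P E Q : Set (Fin d → ℝ))
    (ψ : Set (Fin d → ℝ) → Set (Fin d → ℝ)) : Prop :=
  IsPolytope Q ∧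
  Set.BijOn ψ {G : Set (Fin d → ℝ) | IsFace P G ∧ E ⊆ G} {G : Set (Fin d → ℝ) | IsFace Q G} ∧
  ∀ G₁ ∈ {G : Set (Fin d → ℝ) | IsFace P G ∧ E ⊆ G},
    ∀ G₂ ∈ {G : Set (Fin d → ℝ) | IsFace P G ∧ E ⊆ G}, (G₁ ⊆ G₂ ↔ ψ G₁ ⊆ ψ G₂)

/-- The family `gr` of relative `g`-polynomials satisfies the defining relation
`∑_{F ≤ E ≤ P} g(E,F) g(P/E) = g(P)` (where `g(P/P) = 1`, the quotient by `P`
itself being the empty polytope). -/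
def IsRelG {d : ℕ} (g : Set (Fin d → ℝ) → Polynomial ℤ)
    (gr : Set (Fin d → ℝ) → Set (Fin d → ℝ) → Polynomial ℤ) : Prop :=
  ∀ (P F : Set (Fin d → ℝ)) (Q : Set (Fin d → ℝ) → Set (Fin d → ℝ))
    (ψ : Set (Fin d → ℝ) → Set (Fin d → ℝ) → Set (Fin d → ℝ)),
    IsPolytope P → IsFace P F →
    (∀ E, IsFace P E → F ⊆ E → IsQuotientPair P E (Q E) (ψ E)) →
    (∑ᶠ E ∈ {E : Set (Fin d → ℝ) | IsFace P E ∧ F ⊆ E}, gr E F * g (Q E)) = g P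

/-- A rational polytope: the convex hull of finitely many points with rational
coordinates. -/
def IsRationalPolytope {d : ℕ} (P : Set (Fin d → ℝ)) : Prop :=
  ∃ S : Finset (Fin d → ℝ), (∀ v ∈ S, ∀ i : Fin d, ∃ q : ℚ, v i = (q : ℝ)) ∧
    P = convexHull ℝ (S : Set (Fin d → ℝ))

/-! ### Part A : Kazhdan Lusztig Stanley theory on finite posets -/

set_option linter.unusedSectionVars false

namespace KLS

variable {L : Type*} [Fintype L] [PartialOrder L]

/-- Entrywise reversal. -/
def rev (l : L → L → ℕ) (M : Matrix L L ℤ[X]) : Matrix L L ℤ[X] :=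
  fun x y => reflect (l x y) (M x y)

/-- Upper triangularity with degree bound. -/
def Tri (l : L → L → ℕ) (M : Matrix L L ℤ[X]) : Prop :=
  ∀ x y, (¬ x ≤ y → M x y = 0) ∧ (M x y).natDegree ≤ l x y

/-- The kernel `a ^ l(x,y)`. -/
def Ker (l : L → L → ℕ) (a : ℤ[X]) : Matrix L L ℤ[X] :=
  fun x y => if x ≤ y then a ^ (l x y) else 0

/-- Sign twist. -/
def Tw (l : L → L → ℕ) (M : Matrix L L ℤ[X]) : Matrix L L ℤ[X] :=
  fun x y => (-1) ^ (l x y) * M x y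

lemma rev_mul {l : L → L → ℕ} (hadd : ∀ x y z, x ≤ y → y ≤ z → l x z = l x y + l y z)
    {M N : Matrix L L ℤ[X]} (hM : Tri l M) (hN : Tri l N) :
    rev l (M * N) = rev l M * rev l N := by
  ext1 x y
  simp only [rev, Matrix.mul_apply]
  have : reflect (l x y) (∑ j, M x j * N j y) = ∑ j, reflect (l x y) (M x j * N j y) := by
    induction (Finset.univ : Finset L) using Finset.induction_on with
    | empty => simp
    | insert a s ha ih => rw [Finset.sum_insert ha, Finset.sum_insert ha, reflect_add, ih]
  rw [this]
  refine Finset.sum_congr rfl fun z _ => ?_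
  by_cases h1 : x ≤ z
  · by_cases h2 : z ≤ y
    · rw [hadd x z y h1 h2, reflect_mul _ _ (hM x z).2 (hN z y).2]
    · rw [(hN z y).1 h2]; simp
  · rw [(hM x z).1 h1]; simp

lemma Tri.mul {l : L → L → ℕ} (hadd : ∀ x y z, x ≤ y → y ≤ z → l x z = l x y + l y z)
    {M N : Matrix L L ℤ[X]} (hM : Tri l M) (hN : Tri l N) : Tri l (M * N) := by
  intro x y
  refine ⟨fun h => ?_, ?_⟩
  · rw [Matrix.mul_apply]
    refine Finset.sum_eq_zero fun z _ => ?_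
    by_cases h1 : x ≤ z
    · rw [(hN z y).1 (fun h2 => h (h1.trans h2)), mul_zero]
    · rw [(hM x z).1 h1, zero_mul]
  · rw [Matrix.mul_apply]
    refine natDegree_sum_le_of_forall_le _ _ fun z _ => ?_
    by_cases h1 : x ≤ z
    · by_cases h2 : z ≤ y
      · rw [hadd x z y h1 h2]
        exact natDegree_mul_le.trans (add_le_add (hM x z).2 (hN z y).2)
      · rw [(hN z y).1 h2]; simp
    · rw [(hM x z).1 h1]; simp

lemma ker_tri (l : L → L → ℕ) (a : ℤ[X]) (ha : a.natDegree ≤ 1) : Tri l (Ker l a) := by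
  intro x y
  refine ⟨fun h => by simp [Ker, h], ?_⟩
  unfold Ker
  split_ifs
  · refine natDegree_pow_le.trans ?_
    nlinarith
  · simp

lemma deg_X_sub_one : (X - 1 : ℤ[X]).natDegree ≤ 1 := by
  rw [← C_1]; exact (natDegree_X_sub_C _).le

lemma deg_one_sub_X : (1 - X : ℤ[X]).natDegree ≤ 1 := by
  rw [← natDegree_neg, neg_sub]; exact deg_X_sub_one

lemma reflect_pow' (n : ℕ) : reflect n ((X - 1 : ℤ[X]) ^ n) = (1 - X) ^ n := by
  induction n with
  | zero => simp
  | succ n ih =>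
    rw [pow_succ, reflect_mul _ _ (by
      refine natDegree_pow_le.trans ?_
      have := deg_X_sub_one; nlinarith) deg_X_sub_one, ih, pow_succ, reflect_sub]
    simp

lemma rev_ker (l : L → L → ℕ) : rev l (Ker l (X - 1)) = Ker l (1 - X) := by
  ext1 x y
  simp only [rev, Ker]
  split_ifs
  · exact reflect_pow' _
  · simp

lemma ker_mul_ker {l : L → L → ℕ} (hadd : ∀ x y z, x ≤ y → y ≤ z → l x z = l x y + l y z)
    (heul : ∀ x y, x < y → ∑ z with x ≤ z ∧ z ≤ y, (-1 : ℤ) ^ (l z y) = 0) :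
    Ker l (X - 1) * Ker l (1 - X) = 1 := by
  ext1 x y
  rw [Matrix.mul_apply]
  have hxx : ∀ x : L, l x x = 0 := fun x => by
    have := hadd x x x le_rfl le_rfl; omega
  have : ∀ z, Ker l (X - 1) x z * Ker l (1 - X) z y =
      if x ≤ z ∧ z ≤ y then (X - 1) ^ (l x y) * C ((-1 : ℤ) ^ (l z y)) else 0 := by
    intro z
    unfold Ker
    by_cases h1 : x ≤ z
    · by_cases h2 : z ≤ y
      · simp only [h1, h2, and_self, if_true]
        rw [hadd x z y h1 h2, show (1 - X : ℤ[X]) = (-1) * (X - 1) by ring, mul_pow]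
        simp only [map_pow, map_neg, map_one]
        ring
      · simp [h2]
    · simp [h1]
  simp_rw [this]
  rw [← Finset.sum_filter, ← Finset.mul_sum, ← map_sum]
  by_cases hxy : x = y
  · subst hxy
    have : (Finset.univ.filter fun z => x ≤ z ∧ z ≤ x) = {x} := by
      ext z; simp [le_antisymm_iff, and_comm]
    rw [this]; simp [hxx]
  · rw [Matrix.one_apply_ne hxy]
    by_cases hle : x ≤ y
    · rw [heul x y (lt_of_le_of_ne hle hxy)]; simp
    · have : (Finset.univ.filter fun z => x ≤ z ∧ z ≤ y) = ∅ := by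
        ext z; simp; intro h1 h2; exact hle (h1.trans h2)
      rw [this]; simp

/-- A polynomial antisymmetric under reversal with vanishing low coefficients vanishes. -/
lemma anti_zero {n : ℕ} {E : ℤ[X]} (hdeg : E.natDegree ≤ n) {e : ℤ} (he : e = 1 ∨ e = -1)
    (hr : reflect n E = C e * E) (hmid : 2 * (n / 2) = n → E.coeff (n / 2) = 0)
    (hlo : ∀ i, 2 * i < n → E.coeff i = 0) : E = 0 := by
  ext i
  rw [coeff_zero]
  rcases lt_trichotomy (2 * i) n with h | h | h
  · exact hlo i h
  · have : i = n / 2 := by omega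
    rw [this]; exact hmid (by omega)
  · by_cases hi : i ≤ n
    · have := congrArg (fun p => p.coeff i) hr
      simp only [coeff_reflect, coeff_C_mul, revAt_le hi] at this
      rw [hlo (n - i) (by omega)] at this
      rcases he with rfl | rfl <;> simpa using this.symm
    · exact coeff_eq_zero_of_natDegree_lt (by omega)

theorem kls_left {l : L → L → ℕ} (hadd : ∀ x y z, x ≤ y → y ≤ z → l x z = l x y + l y z)
    (heul : ∀ x y, x < y → ∑ z with x ≤ z ∧ z ≤ y, (-1 : ℤ) ^ (l z y) = 0)
    {G : Matrix L L ℤ[X]} (htri : Tri l G) (hdiag : ∀ x, G x x = 1)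
    (hhi : ∀ x y, x < y → ∀ i, l x y ≤ 2 * i → (G x y).coeff i = 0)
    (hlo : ∀ x y, x < y → ∀ i, 2 * i < l x y → ((G * Ker l (X - 1)) x y).coeff i = 0) :
    G * Ker l (X - 1) = rev l G := by
  have hxx : ∀ x : L, l x x = 0 := fun x => by
    have := hadd x x x le_rfl le_rfl; omega
  have hK := ker_tri l (X - 1) deg_X_sub_one
  have hH := htri.mul hadd hK
  have hrev : rev l (G * Ker l (X - 1)) = rev l G * Ker l (1 - X) := by
    rw [rev_mul hadd htri hK, rev_ker]
  have hGG : (G * Ker l (X - 1)) * Ker l (1 - X) = G := by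
    rw [Matrix.mul_assoc, ker_mul_ker hadd heul, Matrix.mul_one]
  ext1 x y
  induction y using WellFoundedLT.induction with
  | ind y ih =>
  by_cases hle : x ≤ y
  swap
  · rw [(hH x y).1 hle, rev, (htri x y).1 hle]; simp
  rcases hle.eq_or_lt with rfl | hlt
  · rw [Matrix.mul_apply, Finset.sum_eq_single x]
    · simp [rev, Ker, hdiag, hxx]
    · intro z _ hz
      by_cases h1 : x ≤ z
      · have : ¬ z ≤ x := fun h2 => hz (le_antisymm h2 h1)
        simp [Ker, this]
      · rw [(htri x z).1 h1, zero_mul]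
    · simp
  · set H := G * Ker l (X - 1) with hHdef
    have key : reflect (l x y) (H x y) = G x y + (rev l G x y - H x y) := by
      have h1 := congrFun (congrFun hrev x) y
      have h2 := congrFun (congrFun hGG x) y
      rw [Matrix.mul_apply] at h1 h2
      have h3 : ∑ z, rev l G x z * Ker l (1 - X) z y - ∑ z, H x z * Ker l (1 - X) z y
          = rev l G x y - H x y := by
        rw [← Finset.sum_sub_distrib, Finset.sum_eq_single y]
        · simp [Ker, hxx]
        · intro z _ hz
          by_cases hzy : z ≤ y
          · rw [ih z (lt_of_le_of_ne hzy hz), sub_self]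
          · simp [Ker, hzy]
        · simp
      rw [h2, ← h1] at h3
      rw [← h3]; simp only [rev]; ring
    have hE : reflect (l x y) (rev l G x y - H x y) = C (-1) * (rev l G x y - H x y) := by
      rw [reflect_sub, key]
      simp only [rev, reflect_reflect]
      simp only [map_neg, map_one]; ring
    have hEdeg : (rev l G x y - H x y).natDegree ≤ l x y := by
      refine (natDegree_sub_le _ _).trans (max_le ?_ (hH x y).2)
      have := natDegree_reflect_le (N := l x y) (p := G x y)
      exact this.trans (max_le le_rfl (htri x y).2)
    have := anti_zero hEdeg (Or.inr rfl) hE ?_ ?_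
    · exact (sub_eq_zero.1 this).symm
    · intro hmid
      have := congrArg (fun p => p.coeff (l x y / 2)) hE
      simp only [coeff_reflect, coeff_C_mul] at this
      rw [revAt_le (by omega)] at this
      rw [show l x y - l x y / 2 = l x y / 2 by omega] at this
      linarith
    · intro i hi
      rw [coeff_sub, hlo x y hlt i hi, rev, coeff_reflect, revAt_le (by omega),
        hhi x y hlt _ (by omega), sub_zero]

lemma eul_swap {l : L → L → ℕ} (hadd : ∀ x y z, x ≤ y → y ≤ z → l x z = l x y + l y z)
    (heul : ∀ x y, x < y → ∑ z with x ≤ z ∧ z ≤ y, (-1 : ℤ) ^ (l z y) = 0) (x y : L)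
    (hxy : x < y) : ∑ z with x ≤ z ∧ z ≤ y, (-1 : ℤ) ^ (l x z) = 0 := by
  have h := heul x y hxy
  have : ∑ z with x ≤ z ∧ z ≤ y, (-1 : ℤ) ^ (l x z)
      = (-1) ^ (l x y) * ∑ z with x ≤ z ∧ z ≤ y, (-1 : ℤ) ^ (l z y) := by
    rw [Finset.mul_sum]
    refine Finset.sum_congr rfl fun z hz => ?_
    simp only [Finset.mem_filter] at hz
    rw [hadd x z y hz.2.1 hz.2.2, pow_add, mul_assoc, ← mul_pow]; simp
  rw [this, h, mul_zero]

theorem kls_right {l : L → L → ℕ} (hadd : ∀ x y z, x ≤ y → y ≤ z → l x z = l x y + l y z)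
    (heul : ∀ x y, x < y → ∑ z with x ≤ z ∧ z ≤ y, (-1 : ℤ) ^ (l z y) = 0)
    {G : Matrix L L ℤ[X]} (htri : Tri l G) (hdiag : ∀ x, G x x = 1)
    (hhi : ∀ x y, x < y → ∀ i, l x y ≤ 2 * i → (G x y).coeff i = 0)
    (hlo : ∀ x y, x < y → ∀ i, 2 * i < l x y → ((Ker l (X - 1) * G) x y).coeff i = 0) :
    Ker l (X - 1) * G = rev l G := by
  have hKt : Ker (L := Lᵒᵈ) (fun x y => l y x) (X - 1) = (Ker l (X - 1)).transpose := rfl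
  have hmul : ∀ x y : L, ((Ker l (X - 1) * G) x y) =
      (G.transpose * (Ker l (X - 1)).transpose : Matrix L L ℤ[X]) y x := by
    intro x y
    rw [← Matrix.transpose_mul]; rfl
  have := kls_left (L := Lᵒᵈ) (l := fun x y => l y x) (G := G.transpose)
    (fun x y z h1 h2 => by
      have := hadd z y x h2 h1
      omega)
    (fun x y hxy => by
      have h := eul_swap hadd heul y x hxy
      rw [← h]
      refine Finset.sum_congr ?_ fun _ _ => rfl
      have e : ∀ (p q : L → Prop) (ip : DecidablePred p) (iq : DecidablePred q),
          (∀ z, p z ↔ q z) → Finset.univ.filter p = Finset.univ.filter q :=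
        fun p q _ _ h => by ext z; simp [h]
      exact e _ _ _ _ fun z => and_comm)
    (fun x y => htri y x) (fun x => hdiag x) (fun x y hxy i hi => hhi y x hxy i hi)
    (fun x y hxy i hi => by
      have h := hlo y x hxy i hi
      exact (congrArg (fun p => p.coeff i) (hmul y x)).symm.trans h)
  ext1 x y
  rw [hmul]
  exact congrFun (congrFun this y) x

theorem kls_inverse {l : L → L → ℕ} (hadd : ∀ x y z, x ≤ y → y ≤ z → l x z = l x y + l y z)
    (heul : ∀ x y, x < y → ∑ z with x ≤ z ∧ z ≤ y, (-1 : ℤ) ^ (l z y) = 0)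
    {G G' : Matrix L L ℤ[X]} (htri : Tri l G) (hdiag : ∀ x, G x x = 1)
    (hhi : ∀ x y, x < y → ∀ i, l x y ≤ 2 * i → (G x y).coeff i = 0)
    (hlo : ∀ x y, x < y → ∀ i, 2 * i < l x y → ((G * Ker l (X - 1)) x y).coeff i = 0)
    (htri' : Tri l G') (hdiag' : ∀ x, G' x x = 1)
    (hhi' : ∀ x y, x < y → ∀ i, l x y ≤ 2 * i → (G' x y).coeff i = 0)
    (hlo' : ∀ x y, x < y → ∀ i, 2 * i < l x y → ((Ker l (X - 1) * G') x y).coeff i = 0) :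
    G * Tw l G' = 1 := by
  have hxx : ∀ x : L, l x x = 0 := fun x => by
    have := hadd x x x le_rfl le_rfl; omega
  have h1 := kls_left hadd heul htri hdiag hhi hlo
  have h2 := kls_right hadd heul htri' hdiag' hhi' hlo'
  set T : Matrix L L ℤ[X] := Tw l G' with hT
  have hTC : ∀ x y, T x y = C ((-1 : ℤ) ^ (l x y)) * G' x y := by
    intro x y; simp [hT, Tw]
  have hTtri : Tri l T := by
    intro x y
    refine ⟨fun h => by rw [hTC, (htri' x y).1 h, mul_zero], ?_⟩
    rw [hTC]
    exact (natDegree_C_mul_le _ _).trans (htri' x y).2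
  have hTrev : rev l T = Ker l (1 - X) * T := by
    ext1 x y
    have h := congrFun (congrFun h2 x) y
    rw [rev, hTC, reflect_C_mul]
    rw [rev] at h
    rw [← h, Matrix.mul_apply, Matrix.mul_apply, Finset.mul_sum]
    refine Finset.sum_congr rfl fun z _ => ?_
    by_cases hz : x ≤ z
    · by_cases hzy : z ≤ y
      · simp only [Ker, hz, if_true, hTC]
        rw [hadd x z y hz hzy, show (1 - X : ℤ[X]) = (-1) * (X - 1) by ring, mul_pow, pow_add]
        simp only [map_pow, map_neg, map_one, map_mul]
        ring
      · rw [hTC, (htri' z y).1 hzy]; simp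
    · simp [Ker, hz]
  have hD : rev l (G * T) = G * T := by
    rw [rev_mul hadd htri hTtri, ← h1, hTrev, Matrix.mul_assoc, ← Matrix.mul_assoc (Ker l (X - 1)),
      ker_mul_ker hadd heul, Matrix.one_mul]
  have hDtri := htri.mul hadd hTtri
  have hGhi : ∀ x y, ∀ i, l x y < 2 * i → (G x y).coeff i = 0 := by
    intro x y i hi
    by_cases hle : x ≤ y
    · rcases hle.eq_or_lt with rfl | hlt
      · rw [hdiag, coeff_one, if_neg (by omega)]
      · exact hhi x y hlt i hi.le
    · rw [(htri x y).1 hle, coeff_zero]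
  have hThi : ∀ x y, ∀ i, l x y < 2 * i → (T x y).coeff i = 0 := by
    intro x y i hi
    rw [hTC, coeff_C_mul]
    by_cases hle : x ≤ y
    · rcases hle.eq_or_lt with rfl | hlt
      · rw [hdiag', coeff_one, if_neg (by omega), mul_zero]
      · rw [hhi' x y hlt i hi.le, mul_zero]
    · rw [(htri' x y).1 hle, coeff_zero, mul_zero]
  ext1 x y
  by_cases hle : x ≤ y
  swap
  · rw [(hDtri x y).1 hle, Matrix.one_apply_ne]
    rintro rfl; exact hle le_rfl
  rcases hle.eq_or_lt with rfl | hlt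
  · rw [Matrix.one_apply_eq, Matrix.mul_apply, Finset.sum_eq_single x]
    · simp [hT, Tw, hdiag, hdiag', hxx]
    · intro z _ hz
      by_cases h1 : x ≤ z
      · have : ¬ z ≤ x := fun h2 => hz (le_antisymm h2 h1)
        rw [(hTtri z x).1 this, mul_zero]
      · rw [(htri x z).1 h1, zero_mul]
    · simp
  · rw [Matrix.one_apply_ne hlt.ne]
    have hDhi : ∀ i, l x y ≤ 2 * i → ((G * T) x y).coeff i = 0 := by
      intro i hi
      rw [Matrix.mul_apply, finsetSum_coeff]
      refine Finset.sum_eq_zero fun z _ => ?_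
      by_cases hxz : x ≤ z
      swap
      · rw [(htri x z).1 hxz]; simp
      by_cases hzy : z ≤ y
      swap
      · rw [(hTtri z y).1 hzy]; simp
      rw [coeff_mul]
      refine Finset.sum_eq_zero fun p hp => ?_
      rw [Finset.HasAntidiagonal.mem_antidiagonal] at hp
      have hl := hadd x z y hxz hzy
      by_cases ha : l x z < 2 * p.1
      · rw [hGhi x z _ ha, zero_mul]
      by_cases hb : l z y < 2 * p.2
      · rw [hThi z y _ hb, mul_zero]
      rcases hxz.eq_or_lt with rfl | hxz'
      · rw [hTC, coeff_C_mul, hhi' x y hlt p.2 (by have := hxx x; omega)]; simp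
      · rw [hhi x z hxz' p.1 (by omega), zero_mul]
    have hr : reflect (l x y) ((G * T) x y) = C 1 * (G * T) x y := by
      rw [C_1, one_mul]; exact congrFun (congrFun hD x) y
    refine anti_zero (hDtri x y).2 (Or.inl rfl) hr (fun h => hDhi _ h.ge) ?_
    intro i hi
    have := congrArg (fun p => p.coeff i) hr
    simp only [coeff_reflect, coeff_C_mul, one_mul, revAt_le (show i ≤ l x y by omega)] at this
    rw [← this]
    exact hDhi _ (by omega)

end KLS


/-! ### Part B : faces of vector configurations and Euler's relation -/

namespace Cfg

variable {ι V : Type*} [Fintype ι] [AddCommGroup V] [Module ℝ V]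

/-- `A` is a face of the vector configuration `v`. -/
def CFace (v : ι → V) (A : Finset ι) : Prop :=
  ∃ φ : V →ₗ[ℝ] ℝ, (∀ i, 0 ≤ φ (v i)) ∧ ∀ i, i ∈ A ↔ φ (v i) = 0

/-- Rank of a subset of a configuration. -/
def rk (v : ι → V) (A : Finset ι) : ℕ :=
  Module.finrank ℝ (Submodule.span ℝ (v '' (A : Set ι)))

lemma cface_univ (v : ι → V) : CFace v Finset.univ := ⟨0, by simp, by simp⟩

lemma exists_big (a b : ι → ℝ) (A : Finset ι) (hb : ∀ i, i ∉ A → 0 < b i) :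
    ∃ N : ℝ, ∀ i, i ∉ A → a i < N * b i := by
  obtain ⟨N, hN⟩ := Finset.exists_le (Finset.univ.image fun i => a i / b i + 1)
  refine ⟨N, fun i hi => ?_⟩
  have h1 := hN (a i / b i + 1) (Finset.mem_image_of_mem _ (Finset.mem_univ i))
  have h2 : a i / b i < N := by linarith
  rwa [div_lt_iff₀ (hb i hi)] at h2

lemma face_of_face {v : ι → V} {A D : Finset ι} (hA : CFace v A) (f : V →ₗ[ℝ] ℝ)
    (hf : ∀ i ∈ A, f (v i) ≤ 0) (hD : ∀ i, i ∈ D ↔ i ∈ A ∧ f (v i) = 0) : CFace v D := by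
  obtain ⟨φ, hφ, hA⟩ := hA
  obtain ⟨N, hN⟩ := exists_big (fun i => f (v i)) (fun i => φ (v i)) A
    (fun i hi => lt_of_le_of_ne (hφ i) fun h => hi ((hA i).2 h.symm))
  refine ⟨N • φ - f, fun i => ?_, fun i => ?_⟩
  · by_cases hi : i ∈ A
    · simp [(hA i).1 hi, hf i hi]
    · have := hN i hi
      simp; linarith
  · by_cases hi : i ∈ A
    · simp [(hA i).1 hi, hD, hi]
    · have := hN i hi
      simp only [hD, hi, false_and, LinearMap.sub_apply, LinearMap.smul_apply, smul_eq_mul,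
        false_iff]
      linarith

/-- The face of maximal slope. -/
lemma max_slope {v : ι → V} {A B : Finset ι} (hA : CFace v A) (hBA : B ⊂ A) {φ : V →ₗ[ℝ] ℝ}
    (hφ : ∀ i, 0 ≤ φ (v i)) (hB : ∀ i, i ∈ B ↔ φ (v i) = 0) {f : V →ₗ[ℝ] ℝ}
    (hf : ∀ i ∈ B, f (v i) = 0) :
    ∃ D, CFace v D ∧ B ⊂ D ∧ D ⊆ A ∧ ∃ σ : ℝ, (∀ i ∈ D, f (v i) = σ * φ (v i)) ∧
      ∀ i ∈ A, i ∉ D → f (v i) < σ * φ (v i) := by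
  have hpos : ∀ i, i ∉ B → 0 < φ (v i) := fun i hi =>
    lt_of_le_of_ne (hφ i) fun h => hi ((hB i).2 h.symm)
  obtain ⟨hsub, j, hjA, hjB⟩ := Finset.ssubset_iff_exists_cons_subset.1 hBA |>.elim
    (fun a ha => ha.elim fun h1 h2 => (⟨hBA.1, a, h2 (by simp), h1⟩ :
      B ⊆ A ∧ ∃ j, j ∈ A ∧ j ∉ B))
  have hne : (A \ B).Nonempty := ⟨j, by simp [hjA, hjB]⟩
  obtain ⟨m, hm, hmax⟩ := Finset.exists_max_image (A \ B) (fun i => f (v i) / φ (v i)) hne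
  simp only [Finset.mem_sdiff] at hm hmax
  set σ := f (v m) / φ (v m) with hσ
  have hle : ∀ i ∈ A, f (v i) ≤ σ * φ (v i) := by
    intro i hi
    by_cases hiB : i ∈ B
    · rw [hf i hiB, (hB i).1 hiB]; simp
    · have := hmax i ⟨hi, hiB⟩
      rwa [div_le_iff₀ (hpos i hiB)] at this
  refine ⟨A.filter fun i => f (v i) = σ * φ (v i), ?_, ?_, Finset.filter_subset _ _, σ, ?_, ?_⟩
  · refine face_of_face hA (f - σ • φ) (fun i hi => ?_) fun i => ?_
    · have := hle i hi
      simp; linarith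
    · simp [sub_eq_zero]
  · refine Finset.ssubset_iff_subset_ne.2 ⟨fun i hi => ?_, fun h => hm.2 ?_⟩
    · simp [hsub hi, hf i hi, (hB i).1 hi]
    · rw [h, Finset.mem_filter]
      refine ⟨hm.1, ?_⟩
      rw [hσ, div_mul_cancel₀ _ (hpos m hm.2).ne']
  · intro i hi; exact (Finset.mem_filter.1 hi).2
  · intro i hi hn
    refine lt_of_le_of_ne (hle i hi) fun h => hn (Finset.mem_filter.2 ⟨hi, h⟩)

lemma rk_lt [FiniteDimensional ℝ V] {v : ι → V} {B C : Finset ι} (hB : CFace v B) (h : B ⊂ C) :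
    rk v B < rk v C := by
  obtain ⟨φ, hφ, hB⟩ := hB
  obtain ⟨hsub, hns⟩ := h
  obtain ⟨j, hjC, hjB⟩ := Finset.not_subset.1 hns
  refine Submodule.finrank_lt_finrank_of_lt (lt_of_le_of_ne
    (Submodule.span_mono (Set.image_mono hsub)) fun heq => hjB ?_)
  have : v j ∈ Submodule.span ℝ (v '' (B : Set ι)) := by
    rw [heq]; exact Submodule.subset_span ⟨j, hjC, rfl⟩
  have hle : Submodule.span ℝ (v '' (B : Set ι)) ≤ LinearMap.ker φ := by
    rw [Submodule.span_le]
    rintro _ ⟨i, hi, rfl⟩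
    exact (hB i).1 hi
  exact (hB j).2 (hle this)

lemma rk_cover [FiniteDimensional ℝ V] {v : ι → V} {B C : Finset ι} (hB : CFace v B)
    (hC : CFace v C) (h : B ⊂ C) (hcov : ∀ D, CFace v D → B ⊂ D → D ⊆ C → D = C) :
    rk v C = rk v B + 1 := by
  have hlt := rk_lt hB h
  by_contra hne
  obtain ⟨φ, hφ, hBφ⟩ := hB
  obtain ⟨hsub, hns⟩ := id h
  obtain ⟨c, hcC, hcB⟩ := Finset.not_subset.1 hns
  set W := Submodule.span ℝ (v '' (B : Set ι)) with hW
  set U := W ⊔ Submodule.span ℝ {v c} with hU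
  have hUr : Module.finrank ℝ U ≤ rk v B + 1 := by
    refine (Submodule.finrank_add_le_finrank_add_finrank _ _).trans ?_
    refine add_le_add le_rfl ?_
    exact (finrank_span_le_card _).trans (by simp)
  have : ∃ c' ∈ C, v c' ∉ U := by
    by_contra hcon
    push Not at hcon
    have : Submodule.span ℝ (v '' (C : Set ι)) ≤ U := by
      rw [Submodule.span_le]
      rintro _ ⟨i, hi, rfl⟩
      exact hcon i hi
    have := Submodule.finrank_mono this
    unfold rk at *
    omega
  obtain ⟨c', hc'C, hc'⟩ := this
  obtain ⟨f, hf1, hf2⟩ := Submodule.exists_le_ker_of_notMem hc'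
  have hfB : ∀ i ∈ B, f (v i) = 0 := fun i hi =>
    hf2 (Submodule.mem_sup_left (Submodule.subset_span ⟨i, hi, rfl⟩))
  have hfc : f (v c) = 0 := hf2 (Submodule.mem_sup_right (Submodule.subset_span rfl))
  obtain ⟨D, hD, hBD, hDC, σ, h1, -⟩ := max_slope hC h hφ hBφ hfB
  have hDeq := hcov D hD hBD hDC
  subst hDeq
  have hcpos : φ (v c) ≠ 0 := fun h => hcB ((hBφ c).2 h)
  have h2 := h1 c hcC
  rw [hfc] at h2
  have hσ : σ = 0 := by
    rcases mul_eq_zero.1 h2.symm with h | h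
    · exact h
    · exact absurd h hcpos
  have h3 := h1 c' hc'C
  rw [hσ, zero_mul] at h3
  exact hf1 h3

/-- Faces of `[B,C]` on which `f` is negative off `B`. -/
def SF (v : ι → V) (B C : Finset ι) (f : V →ₗ[ℝ] ℝ) : Finset (Finset ι) :=
  Finset.univ.filter fun A => CFace v A ∧ B ⊆ A ∧ A ⊆ C ∧ ∀ i ∈ A, i ∉ B → f (v i) < 0

lemma mem_SF {v : ι → V} {B C A : Finset ι} {f : V →ₗ[ℝ] ℝ} :
    A ∈ SF v B C f ↔ CFace v A ∧ B ⊆ A ∧ A ⊆ C ∧ ∀ i ∈ A, i ∉ B → f (v i) < 0 := by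
  simp [SF]

lemma sum_SF_trivial {v : ι → V} {B C : Finset ι} {f : V →ₗ[ℝ] ℝ} (hB : CFace v B) (hBC : B ⊆ C)
    (hf : ∀ i ∈ C, i ∉ B → 0 ≤ f (v i)) :
    ∑ A ∈ SF v B C f, (-1 : ℤ) ^ rk v A = (-1) ^ rk v B := by
  have : SF v B C f = {B} := by
    ext A
    rw [mem_SF, Finset.mem_singleton]
    constructor
    · rintro ⟨-, h1, h2, h3⟩
      refine Finset.Subset.antisymm (fun i hi => ?_) h1
      by_contra hiB
      exact absurd (h3 i hi hiB) (not_lt.2 (hf i (h2 hi) hiB))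
    · rintro rfl
      exact ⟨hB, le_rfl, hBC, fun i h1 h2 => absurd h1 h2⟩
  rw [this, Finset.sum_singleton]

lemma euler_step {v : ι → V} {B C : Finset ι} (hC : CFace v C) (hBC : B ⊂ C)
    (ih : ∀ B' C', CFace v B' → CFace v C' → B' ⊆ C' → (C' \ B').card < (C \ B).card →
      ∀ f : V →ₗ[ℝ] ℝ, (∀ i ∈ B', f (v i) = 0) → (∃ i ∈ C', i ∉ B' ∧ f (v i) < 0) →
      ∑ A ∈ SF v B' C' f, (-1 : ℤ) ^ rk v A = 0)
    {φ : V →ₗ[ℝ] ℝ} (hφ : ∀ i, 0 ≤ φ (v i)) (hB : ∀ i, i ∈ B ↔ φ (v i) = 0)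
    {f : V →ₗ[ℝ] ℝ} (hf : ∀ i ∈ B, f (v i) = 0) (hneg : ∃ i ∈ C, i ∉ B ∧ f (v i) < 0)
    (hncon : ¬ ∃ σ : ℝ, ∀ i ∈ C, f (v i) = σ * φ (v i)) :
    ∑ A ∈ SF v B C f, (-1 : ℤ) ^ rk v A = 0 := by
  have hBf : CFace v B := ⟨φ, hφ, hB⟩
  have hpos : ∀ i, i ∉ B → 0 < φ (v i) := fun i hi =>
    lt_of_le_of_ne (hφ i) fun h => hi ((hB i).2 h.symm)
  -- the minimal slope face
  obtain ⟨M, hM, hBM, hMC, σ', hM1', hM2'⟩ := max_slope hC hBC hφ hB (f := -f)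
    (fun i hi => by simp [hf i hi])
  obtain ⟨m, rfl⟩ : ∃ m, σ' = -m := ⟨-σ', by ring⟩
  have hM1 : ∀ i ∈ M, f (v i) = m * φ (v i) := fun i hi => by
    have := hM1' i hi; simp at this; linarith
  have hM2 : ∀ i ∈ C, i ∉ M → m * φ (v i) < f (v i) := fun i hi hn => by
    have := hM2' i hi hn; simp at this; linarith
  have hM3 : ∀ i ∈ C, m * φ (v i) ≤ f (v i) := fun i hi => by
    by_cases h : i ∈ M
    · exact (hM1 i h).ge
    · exact (hM2 i hi h).le
  have hMneC : M ≠ C := fun h => hncon ⟨m, fun i hi => hM1 i (h ▸ hi)⟩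
  have hm : m < 0 := by
    obtain ⟨i, hiC, hiB, hi⟩ := hneg
    by_contra hm
    have := hM3 i hiC
    have := mul_nonneg (not_lt.1 hm) (hφ i)
    linarith
  -- top faces
  have hex : ∀ A, ∃ D, CFace v A → B ⊂ A → CFace v D ∧ B ⊂ D ∧ D ⊆ A ∧ ∃ σ : ℝ,
      (∀ i ∈ D, f (v i) = σ * φ (v i)) ∧ ∀ i ∈ A, i ∉ D → f (v i) < σ * φ (v i) := by
    intro A
    by_cases h : CFace v A ∧ B ⊂ A
    · obtain ⟨D, hD⟩ := max_slope h.1 h.2 hφ hB hf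
      exact ⟨D, fun _ _ => hD⟩
    · exact ⟨∅, fun h1 h2 => absurd ⟨h1, h2⟩ h⟩
  choose T hT using hex
  have huniq : ∀ A D, CFace v A → B ⊂ A → B ⊂ D → D ⊆ A → (∃ σ : ℝ,
      (∀ i ∈ D, f (v i) = σ * φ (v i)) ∧ ∀ i ∈ A, i ∉ D → f (v i) < σ * φ (v i)) → T A = D := by
    intro A D hA hBA hBD hDA ⟨σ, h1, h2⟩
    obtain ⟨-, hBT, hTA, τ, h3, h4⟩ := hT A hA hBA
    have h2' : ∀ i ∈ A, f (v i) ≤ σ * φ (v i) := fun i hi => by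
      by_cases h : i ∈ D
      · exact (h1 i h).le
      · exact (h2 i hi h).le
    have h4' : ∀ i ∈ A, f (v i) ≤ τ * φ (v i) := fun i hi => by
      by_cases h : i ∈ T A
      · exact (h3 i h).le
      · exact (h4 i hi h).le
    have hst : σ = τ := by
      obtain ⟨i, hiD, hiB⟩ := Finset.not_subset.1 hBD.2
      obtain ⟨j, hjT, hjB⟩ := Finset.not_subset.1 hBT.2
      have e1 := h4' i (hDA hiD)
      rw [h1 i hiD] at e1
      have e2 := h2' j (hTA hjT)
      rw [h3 j hjT] at e2
      exact le_antisymm (le_of_mul_le_mul_right e1 (hpos i hiB))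
        (le_of_mul_le_mul_right e2 (hpos j hjB))
    subst hst
    ext i
    constructor
    · intro hi
      by_contra hn
      exact absurd (h3 i hi) (h2 i (hTA hi) hn).ne
    · intro hi
      by_contra hn
      exact absurd (h1 i hi) (h4 i (hDA hi) hn).ne
  have hBS : B ∈ SF v B C f :=
    mem_SF.2 ⟨hBf, le_rfl, hBC.1, fun i h1 h2 => absurd h1 h2⟩
  have hBS' : B ∈ SF v B M (-φ) :=
    mem_SF.2 ⟨hBf, le_rfl, hBM.1, fun i h1 h2 => absurd h1 h2⟩
  have hMsum : ∑ A ∈ SF v B M (-φ), (-1 : ℤ) ^ rk v A = 0 := by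
    refine ih B M hBf hM hBM.1 ?_ (-φ) (fun i hi => by simp [(hB i).1 hi]) ?_
    · refine Finset.card_lt_card ?_
      refine Finset.ssubset_iff_subset_ne.2 ⟨Finset.sdiff_subset_sdiff hMC le_rfl, fun h => ?_⟩
      apply hMneC
      refine Finset.Subset.antisymm hMC fun i hi => ?_
      by_cases hiB : i ∈ B
      · exact hBM.1 hiB
      · have : i ∈ C \ B := by simp [hi, hiB]
        rw [← h] at this
        exact (Finset.mem_sdiff.1 this).1
    · obtain ⟨i, hiM, hiB⟩ := Finset.not_subset.1 hBM.2
      exact ⟨i, hiM, hiB, by simpa using hpos i hiB⟩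
  rw [← Finset.sum_erase_add _ _ hBS] 
  rw [← Finset.sum_erase_add _ _ hBS'] at hMsum
  rw [← hMsum]
  congr 1
  rw [← Finset.sum_fiberwise_of_maps_to (g := T) (t := Finset.univ) (fun _ _ => Finset.mem_univ _)]
  rw [← Finset.sum_filter_add_sum_filter_not Finset.univ (fun D => D ∈ (SF v B M (-φ)).erase B)]
  have hinner : ∀ D, ∑ A ∈ (SF v B C f).erase B with T A = D, (-1 : ℤ) ^ rk v A =
      if D ∈ (SF v B M (-φ)).erase B then (-1) ^ rk v D else 0 := by
    intro D
    by_cases hD : ∃ A₀ ∈ (SF v B C f).erase B, T A₀ = D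
    · obtain ⟨A₀, hA₀, rfl⟩ := hD
      rw [Finset.mem_erase, mem_SF] at hA₀
      obtain ⟨hne, hA₀f, hBA₀, hA₀C, hA₀n⟩ := hA₀
      have hBA₀' : B ⊂ A₀ := Finset.ssubset_iff_subset_ne.2 ⟨hBA₀, hne.symm⟩
      obtain ⟨hDf, hBD, hDA, σ, hD1, hD2⟩ := hT A₀ hA₀f hBA₀'
      generalize T A₀ = D at *
      obtain ⟨k, hkD, hkB⟩ := Finset.not_subset.1 hBD.2
      have hσ : σ < 0 := by
        have h1 := hA₀n k (hDA hkD) hkB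
        rw [hD1 k hkD] at h1
        by_contra hσ
        have := mul_nonneg (not_lt.1 hσ) (hφ k)
        linarith
      have hset : ((SF v B C f).erase B).filter (fun A => T A = D) = SF v D C (f - σ • φ) := by
        ext A
        rw [Finset.mem_filter, Finset.mem_erase, mem_SF, mem_SF]
        constructor
        · rintro ⟨⟨hne, hAf, hBA, hAC, hAn⟩, hTA⟩
          have hBA' : B ⊂ A := Finset.ssubset_iff_subset_ne.2 ⟨hBA, hne.symm⟩
          obtain ⟨-, -, hDA', τ, h1, h2⟩ := hT A hAf hBA'
          rw [hTA] at h1 h2 hDA'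
          have : τ = σ := by
            have := h1 k hkD
            rw [hD1 k hkD] at this
            exact (mul_right_cancel₀ (hpos k hkB).ne' this).symm
          subst this
          refine ⟨hAf, hDA', hAC, fun i hi hn => ?_⟩
          have := h2 i hi hn
          simp; linarith
        · rintro ⟨hAf, hDA', hAC, hAn⟩
          have hBA' : B ⊂ A := lt_of_lt_of_le hBD hDA'
          have hAn' : ∀ i ∈ A, i ∉ D → f (v i) < σ * φ (v i) := fun i hi hn => by
            have := hAn i hi hn
            simp at this; linarith
          refine ⟨⟨(Finset.ssubset_iff_subset_ne.1 hBA').2.symm, hAf, hBA'.1, hAC, fun i hi hn => ?_⟩,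
            huniq A D hAf hBA' hBD hDA' ⟨σ, hD1, hAn'⟩⟩
          have h1 : σ * φ (v i) < 0 := mul_neg_of_neg_of_pos hσ (hpos i hn)
          by_cases hiD : i ∈ D
          · rw [hD1 i hiD]; exact h1
          · exact (hAn' i hi hiD).trans h1
      rw [hset]
      have hDC : D ⊆ C := hDA.trans hA₀C
      by_cases hlow : ∃ i ∈ C, i ∉ D ∧ (f - σ • φ) (v i) < 0
      · rw [ih D C hDf hC hDC ?_ _ ?_ hlow, if_neg]
        · intro hmem
          rw [Finset.mem_erase, mem_SF] at hmem
          obtain ⟨-, -, -, hDM, -⟩ := hmem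
          have h1 := hM1 k (hDM hkD)
          rw [hD1 k hkD] at h1
          have := mul_right_cancel₀ (hpos k hkB).ne' h1
          subst this
          obtain ⟨i, hiC, -, hi⟩ := hlow
          have := hM3 i hiC
          simp at hi; linarith
        · refine Finset.card_lt_card ?_
          refine Finset.ssubset_iff_subset_ne.2 ⟨Finset.sdiff_subset_sdiff le_rfl hBD.1, fun h => ?_⟩
          have : k ∈ C \ B := by simp [hDC hkD, hkB]
          rw [← h] at this
          exact (Finset.mem_sdiff.1 this).2 hkD
        · intro i hi
          simp [hD1 i hi]
      · push Not at hlow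
        rw [sum_SF_trivial hDf hDC hlow, if_pos]
        have hge : ∀ i ∈ C, σ * φ (v i) ≤ f (v i) := fun i hi => by
          by_cases h : i ∈ D
          · exact (hD1 i h).ge
          · have := hlow i hi h
            simp at this; linarith
        have hσm : σ = m := by
          obtain ⟨j, hjM, hjB⟩ := Finset.not_subset.1 hBM.2
          have e1 := hge j (hMC hjM)
          rw [hM1 j hjM] at e1
          have e2 := hM3 k (hDC hkD)
          rw [hD1 k hkD] at e2
          exact le_antisymm (le_of_mul_le_mul_right e1 (hpos j hjB))
            (le_of_mul_le_mul_right e2 (hpos k hkB))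
        subst hσm
        rw [Finset.mem_erase, mem_SF]
        refine ⟨(Finset.ssubset_iff_subset_ne.1 hBD).2.symm, hDf, hBD.1, fun i hi => ?_,
          fun i _ hn => by simpa using hpos i hn⟩
        by_contra hn
        exact absurd (hD1 i hi) (hM2 i (hDC hi) hn).ne'
    · have hemp : ((SF v B C f).erase B).filter (fun A => T A = D) = ∅ := by
        refine Finset.filter_eq_empty_iff.2 fun A hA h => hD ⟨A, hA, h⟩
      rw [hemp, Finset.sum_empty, if_neg]
      intro hmem
      apply hD
      rw [Finset.mem_erase, mem_SF] at hmem
      obtain ⟨hne, hDf, hBD, hDM, -⟩ := hmem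
      have hBD' : B ⊂ D := Finset.ssubset_iff_subset_ne.2 ⟨hBD, hne.symm⟩
      refine ⟨D, ?_, huniq D D hDf hBD' hBD' le_rfl ⟨m, fun i hi => hM1 i (hDM hi),
        fun i h1 h2 => absurd h1 h2⟩⟩
      rw [Finset.mem_erase, mem_SF]
      refine ⟨hne, hDf, hBD, hDM.trans hMC, fun i hi hn => ?_⟩
      rw [hM1 i (hDM hi)]
      exact mul_neg_of_neg_of_pos hm (hpos i hn)
  simp_rw [hinner]
  rw [Finset.sum_filter_add_sum_filter_not, ← Finset.sum_filter]
  refine Finset.sum_congr ?_ fun _ _ => rfl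
  ext D; simp

theorem euler_aux [FiniteDimensional ℝ V] (v : ι → V) (n : ℕ) : ∀ B C : Finset ι, CFace v B →
    CFace v C → B ⊆ C → (C \ B).card < n → ∀ f : V →ₗ[ℝ] ℝ, (∀ i ∈ B, f (v i) = 0) →
    (∃ i ∈ C, i ∉ B ∧ f (v i) < 0) → ∑ A ∈ SF v B C f, (-1 : ℤ) ^ rk v A = 0 := by
  induction n with
  | zero => intro B C _ _ _ h; omega
  | succ n ih =>
    intro B C hB hC hBC hcard f hf hneg
    have hBC' : B ⊂ C := by
      refine Finset.ssubset_iff_subset_ne.2 ⟨hBC, ?_⟩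
      rintro rfl
      obtain ⟨i, h1, h2, -⟩ := hneg
      exact h2 h1
    have ih' : ∀ B' C', CFace v B' → CFace v C' → B' ⊆ C' → (C' \ B').card < (C \ B).card →
      ∀ f : V →ₗ[ℝ] ℝ, (∀ i ∈ B', f (v i) = 0) → (∃ i ∈ C', i ∉ B' ∧ f (v i) < 0) →
      ∑ A ∈ SF v B' C' f, (-1 : ℤ) ^ rk v A = 0 :=
      fun B' C' h1 h2 h3 h4 => ih B' C' h1 h2 h3 (by omega)
    obtain ⟨φ, hφ, hBφ⟩ := id hB
    have hpos : ∀ i, i ∉ B → 0 < φ (v i) := fun i hi =>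
      lt_of_le_of_ne (hφ i) fun h => hi ((hBφ i).2 h.symm)
    by_cases hcon : ∃ σ : ℝ, ∀ i ∈ C, f (v i) = σ * φ (v i)
    swap
    · exact euler_step hC hBC' ih' hφ hBφ hf hneg hcon
    obtain ⟨σ, hσ⟩ := hcon
    have hσneg : σ < 0 := by
      obtain ⟨i, hiC, -, hi⟩ := hneg
      rw [hσ i hiC] at hi
      by_contra h
      have := mul_nonneg (not_lt.1 h) (hφ i)
      linarith
    have hfneg : ∀ i ∈ C, i ∉ B → f (v i) < 0 := fun i hi hn => by
      rw [hσ i hi]; exact mul_neg_of_neg_of_pos hσneg (hpos i hn)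
    by_cases hbet : ∃ D, CFace v D ∧ B ⊂ D ∧ D ⊂ C
    · obtain ⟨D, hD, hBD, hDC⟩ := hbet
      obtain ⟨χ, hχ, hDχ⟩ := hD
      have hf'neg : ∀ i ∈ C, i ∉ B → (-(χ + φ)) (v i) < 0 := fun i _ hn => by
        have := hpos i hn
        have := hχ i
        simp; linarith
      have hsame : SF v B C f = SF v B C (-(χ + φ)) := by
        ext A
        rw [mem_SF, mem_SF]
        constructor
        · rintro ⟨h1, h2, h3, -⟩
          exact ⟨h1, h2, h3, fun i hi hn => hf'neg i (h3 hi) hn⟩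
        · rintro ⟨h1, h2, h3, -⟩
          exact ⟨h1, h2, h3, fun i hi hn => hfneg i (h3 hi) hn⟩
      rw [hsame]
      obtain ⟨i, hiD, hiB⟩ := Finset.not_subset.1 hBD.2
      obtain ⟨j, hjC, hjD⟩ := Finset.not_subset.1 hDC.2
      refine euler_step hC hBC' ih' hφ hBφ ?_ ⟨i, hDC.1 hiD, hiB, hf'neg i (hDC.1 hiD) hiB⟩ ?_
      · intro k hk
        simp [(hBφ k).1 hk, (hDχ k).1 (hBD.1 hk)]
      · rintro ⟨τ, hτ⟩
        have h1 := hτ i (hDC.1 hiD)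
        have h2 := hτ j hjC
        simp only [LinearMap.neg_apply, LinearMap.add_apply, (hDχ i).1 hiD] at h1 h2
        have hi := hpos i hiB
        have hτ1 : τ = -1 := by
          apply mul_right_cancel₀ hi.ne'
          linarith
        subst hτ1
        exact hjD ((hDχ j).2 (by linarith))
    · have hr := rk_cover hB hC hBC' (fun D hD h1 h2 => by
        by_contra hne
        exact hbet ⟨D, hD, h1, Finset.ssubset_iff_subset_ne.2 ⟨h2, hne⟩⟩)
      have : SF v B C f = {B, C} := by
        ext A
        rw [mem_SF, Finset.mem_insert, Finset.mem_singleton]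
        constructor
        · rintro ⟨h1, h2, h3, -⟩
          by_contra hne
          push Not at hne
          exact hbet ⟨A, h1, Finset.ssubset_iff_subset_ne.2 ⟨h2, hne.1.symm⟩,
            Finset.ssubset_iff_subset_ne.2 ⟨h3, hne.2⟩⟩
        · rintro (rfl | rfl)
          · exact ⟨hB, le_rfl, hBC, fun i h1 h2 => absurd h1 h2⟩
          · exact ⟨hC, hBC, le_rfl, hfneg⟩
      rw [this, Finset.sum_pair (Finset.ssubset_iff_subset_ne.1 hBC').2, hr, pow_succ]
      ring

/-- Euler's relation for intervals of faces of a configuration. -/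
theorem euler [FiniteDimensional ℝ V] (v : ι → V) {B C : Finset ι} (hB : CFace v B)
    (hC : CFace v C) (hBC : B ⊂ C) :
    ∑ A with CFace v A ∧ B ⊆ A ∧ A ⊆ C, (-1 : ℤ) ^ rk v A = 0 := by
  obtain ⟨φ, hφ, hBφ⟩ := id hB
  have hpos : ∀ i, i ∉ B → 0 < φ (v i) := fun i hi =>
    lt_of_le_of_ne (hφ i) fun h => hi ((hBφ i).2 h.symm)
  obtain ⟨i, hiC, hiB⟩ := Finset.not_subset.1 hBC.2
  rw [← euler_aux v _ B C hB hC hBC.1 (Nat.lt_succ_self _) (-φ)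
    (fun i hi => by simp [(hBφ i).1 hi]) ⟨i, hiC, hiB, by simpa using hpos i hiB⟩]
  refine Finset.sum_congr ?_ fun _ _ => rfl
  ext A
  rw [mem_SF, Finset.mem_filter]
  constructor
  · rintro ⟨-, h1, h2, h3⟩
    exact ⟨h1, h2, h3, fun i _ hn => by simpa using hpos i hn⟩
  · rintro ⟨h1, h2, h3, -⟩
    exact ⟨Finset.mem_univ _, h1, h2, h3⟩

end Cfg



namespace Cfg

/-- Weyl's theorem: a finitely generated cone is an intersection of finitely many half-spaces. -/
lemma weyl {ι V : Type*} [AddCommGroup V] [Module ℝ V] [FiniteDimensional ℝ V]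
    (v : ι → V) (s : Finset ι) :
    ∃ T : Finset (V →ₗ[ℝ] ℝ), ∀ x, (∃ c : ι → ℝ, (∀ i, 0 ≤ c i) ∧ x = ∑ i ∈ s, c i • v i) ↔
      ∀ φ ∈ T, 0 ≤ φ x := by
  induction s using Finset.induction_on with
  | empty =>
    let b := Module.finBasis ℝ V
    refine ⟨(Finset.univ.image fun i => b.coord i) ∪ (Finset.univ.image fun i => -b.coord i),
      fun x => ⟨?_, fun h => ⟨0, by simp, ?_⟩⟩⟩
    · rintro ⟨c, -, rfl⟩
      simp
    · simp only [Finset.sum_empty]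
      apply b.ext_elem
      intro i
      have h1 := h (b.coord i) (by simp)
      have h2 := h (-b.coord i) (by simp)
      simp only [LinearMap.neg_apply, Module.Basis.coord_apply] at h1 h2
      simp only [map_zero, Finsupp.coe_zero, Pi.zero_apply]
      linarith
  | insert a s ha ih =>
    obtain ⟨T, hT⟩ := ih
    refine ⟨(T.filter fun φ => 0 ≤ φ (v a)) ∪
      (((T.filter fun φ => 0 < φ (v a)) ×ˢ (T.filter fun φ => φ (v a) < 0)).image
        fun p => p.1 (v a) • p.2 - p.2 (v a) • p.1), fun x => ⟨?_, fun h => ?_⟩⟩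
    · rintro ⟨c, hc, rfl⟩ φ hφ
      rw [Finset.sum_insert ha]
      have key : ∀ φ ∈ T, 0 ≤ φ (∑ i ∈ s, c i • v i) := (hT _).1 ⟨c, hc, rfl⟩
      rcases Finset.mem_union.1 hφ with hφ | hφ
      · rw [Finset.mem_filter] at hφ
        rw [map_add, map_smul, smul_eq_mul]
        exact add_nonneg (mul_nonneg (hc a) hφ.2) (key φ hφ.1)
      · obtain ⟨⟨φ₁, φ₂⟩, hp, rfl⟩ := Finset.mem_image.1 hφ
        simp only [Finset.mem_product, Finset.mem_filter] at hp
        have k1 := key φ₁ hp.1.1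
        have k2 := key φ₂ hp.2.1
        set y := ∑ i ∈ s, c i • v i
        simp only [map_add, map_smul, LinearMap.sub_apply, LinearMap.smul_apply, smul_eq_mul]
        have := mul_nonneg hp.1.2.le k2
        have := mul_nonneg (neg_nonneg.2 hp.2.2.le) k1
        nlinarith
    · have hA : ∀ φ ∈ T, 0 ≤ φ (v a) → 0 ≤ φ x := fun φ h1 h2 =>
        h φ (Finset.mem_union_left _ (Finset.mem_filter.2 ⟨h1, h2⟩))
      have hB : ∀ φ ∈ T, ∀ ψ ∈ T, 0 < φ (v a) → ψ (v a) < 0 →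
          0 ≤ φ (v a) * ψ x - ψ (v a) * φ x := fun φ h1 ψ h2 h3 h4 => by
        have := h (φ (v a) • ψ - ψ (v a) • φ) (Finset.mem_union_right _
          (Finset.mem_image.2 ⟨(φ, ψ), by simp [h1, h2, h3, h4], rfl⟩))
        simpa using this
      obtain ⟨t, ht0, ht1, ht2⟩ : ∃ t : ℝ, 0 ≤ t ∧ (∀ ψ ∈ T, ψ (v a) < 0 → ψ x / ψ (v a) ≤ t) ∧
          (t = 0 ∨ ∃ ψ ∈ T, ψ (v a) < 0 ∧ t = ψ x / ψ (v a)) := by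
        set S := insert (0:ℝ) ((T.filter fun ψ => ψ (v a) < 0).image fun ψ => ψ x / ψ (v a)) with hS
        have hne : S.Nonempty := ⟨0, by simp [hS]⟩
        refine ⟨S.max' hne, S.le_max' _ (by simp [hS]), fun ψ h1 h2 => S.le_max' _ ?_, ?_⟩
        · rw [hS]
          exact Finset.mem_insert_of_mem (Finset.mem_image.2 ⟨ψ, by simp [h1, h2], rfl⟩)
        · have := S.max'_mem hne
          nth_rewrite 1 [hS] at this
          rcases Finset.mem_insert.1 this with h | h
          · exact Or.inl h
          · obtain ⟨ψ, h1, h2⟩ := Finset.mem_image.1 h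
            rw [Finset.mem_filter] at h1
            exact Or.inr ⟨ψ, h1.1, h1.2, h2.symm⟩
      have : ∀ φ ∈ T, 0 ≤ φ (x - t • v a) := by
        intro φ hφ
        rw [map_sub, map_smul, smul_eq_mul]
        rcases lt_trichotomy (φ (v a)) 0 with h0 | h0 | h0
        · have := ht1 φ hφ h0
          rw [div_le_iff_of_neg h0] at this
          linarith
        · have := hA φ hφ h0.ge
          rw [h0]; simpa using this
        · rcases ht2 with rfl | ⟨ψ, h1, h2, rfl⟩
          · have := hA φ hφ h0.le
            simpa using this
          · have := hB φ hφ ψ h1 h0 h2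
            have e : φ x - ψ x / ψ (v a) * φ (v a) =
              (φ (v a) * ψ x - ψ (v a) * φ x) / (-ψ (v a)) := by
              have := h2.ne
              field_simp; ring
            rw [e]
            exact div_nonneg this (by linarith)
      obtain ⟨c, hc, hx⟩ := (hT _).2 this
      refine ⟨Function.update c a t, fun i => ?_, ?_⟩
      · by_cases hi : i = a
        · subst hi; simpa using ht0
        · simpa [hi] using hc i
      · rw [Finset.sum_insert ha, Function.update_self, Finset.sum_congr rfl
          (g := fun i => c i • v i), ← hx]
        · abel
        · intro i hi
          rw [Function.update_of_ne (fun h : i = a => ha (h ▸ hi))]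

/-- Existence of a dual configuration. -/
lemma exists_dual {ι V : Type*} [Fintype ι] [AddCommGroup V] [Module ℝ V] [FiniteDimensional ℝ V]
    (v : ι → V) : ∃ T : Finset (V →ₗ[ℝ] ℝ), (∀ φ ∈ T, φ ≠ 0) ∧ (∀ φ ∈ T, ∀ i, 0 ≤ φ (v i)) ∧
      (∀ x, (∀ φ ∈ T, 0 ≤ φ x) → ∃ c : ι → ℝ, (∀ i, 0 ≤ c i) ∧ x = ∑ i, c i • v i) ∧
      (∀ ψ : V →ₗ[ℝ] ℝ, (∀ i, 0 ≤ ψ (v i)) → ∃ c : (V →ₗ[ℝ] ℝ) → ℝ, (∀ i, 0 ≤ c i) ∧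
        ψ = ∑ φ ∈ T, c φ • φ) := by
  obtain ⟨T, hT⟩ := weyl v Finset.univ
  have h0 : ∀ x, (∀ φ ∈ T.erase 0, 0 ≤ φ x) ↔ (∀ φ ∈ T, 0 ≤ φ x) := fun x => by
    refine ⟨fun h φ hφ => ?_, fun h φ hφ => h φ (Finset.mem_of_mem_erase hφ)⟩
    by_cases h1 : φ = 0
    · simp [h1]
    · exact h φ (Finset.mem_erase.2 ⟨h1, hφ⟩)
  simp only [← h0] at hT
  refine ⟨T.erase 0, fun φ hφ => (Finset.mem_erase.1 hφ).1, fun φ hφ i => ?_,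
    fun x => (hT x).2, fun ψ hψ => ?_⟩
  · refine (hT (v i)).1 ⟨Pi.single i 1, fun j => ?_, ?_⟩ φ hφ
    · by_cases h : j = i
      · subst h; simp
      · simp [h]
    · rw [Finset.sum_eq_single i] <;> simp +contextual
  · obtain ⟨S, hS⟩ := weyl (V := Module.Dual ℝ V) (fun φ : Module.Dual ℝ V => φ) (T.erase 0)
    refine (hS ψ).2 fun Φ hΦ => ?_
    obtain ⟨x, rfl⟩ := (Module.evalEquiv ℝ V).surjective Φ
    have hx : ∀ φ ∈ T.erase 0, 0 ≤ φ x := fun φ hφ => by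
      have := (hS φ).1 ⟨Pi.single φ 1, fun j => ?_, ?_⟩ _ hΦ
      · simpa using this
      · by_cases h : j = φ
        · subst h; simp
        · simp [h]
      · rw [Finset.sum_eq_single φ]
        · simp
        · intro b _ hb; simp [hb]
        · intro h; exact absurd hφ h
    obtain ⟨c, hc, rfl⟩ := (hT x).2 hx
    have e : (Module.evalEquiv ℝ V) (∑ i, c i • v i) ψ = ∑ i, c i * ψ (v i) := by
      change ψ (∑ i, c i • v i) = _
      simp
    rw [e]
    exact Finset.sum_nonneg fun i _ => mul_nonneg (hc i) (hψ i)

/-- Faces of a configuration and of its dual configuration are anti-isomorphic. -/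
lemma dual_iso {ι V : Type*} [Fintype ι] [AddCommGroup V] [Module ℝ V] [FiniteDimensional ℝ V]
    (v : ι → V) (T : Finset (V →ₗ[ℝ] ℝ)) (hT : ∀ φ ∈ T, ∀ i, 0 ≤ φ (v i))
    (h1 : ∀ x, (∀ φ ∈ T, 0 ≤ φ x) → ∃ c : ι → ℝ, (∀ i, 0 ≤ c i) ∧ x = ∑ i, c i • v i)
    (h2 : ∀ ψ : V →ₗ[ℝ] ℝ, (∀ i, 0 ≤ ψ (v i)) → ∃ c : (V →ₗ[ℝ] ℝ) → ℝ, (∀ i, 0 ≤ c i) ∧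
        ψ = ∑ φ ∈ T, c φ • φ) :
    Nonempty ({A : Finset ι // CFace v A} ≃o
      ({B : Finset T // CFace (fun j : T => (j : Module.Dual ℝ V)) B})ᵒᵈ) := by
  let w : T → Module.Dual ℝ V := fun j => j
  let a : Finset ι → Finset T := fun A => Finset.univ.filter fun j => ∀ i ∈ A, w j (v i) = 0
  let b : Finset T → Finset ι := fun B => Finset.univ.filter fun i => ∀ j ∈ B, w j (v i) = 0
  have ha : ∀ A j, j ∈ a A ↔ ∀ i ∈ A, w j (v i) = 0 := fun A j => by simp [a]
  have hb : ∀ B i, i ∈ b B ↔ ∀ j ∈ B, w j (v i) = 0 := fun B i => by simp [b]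
  have hw : ∀ j i, 0 ≤ w j (v i) := fun j i => hT _ j.2 i
  have hfa : ∀ A, CFace w (a A) := fun A => by
    refine ⟨Module.Dual.eval ℝ V (∑ i ∈ A, v i), fun j => ?_, fun j => ?_⟩
    · rw [Module.Dual.eval_apply, map_sum]
      exact Finset.sum_nonneg fun i _ => hw j i
    · rw [Module.Dual.eval_apply, map_sum, ha, Finset.sum_eq_zero_iff_of_nonneg fun i _ => hw j i]
  have hfb : ∀ B, CFace v (b B) := fun B => by
    refine ⟨∑ j ∈ B, w j, fun i => ?_, fun i => ?_⟩
    · rw [LinearMap.sum_apply]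
      exact Finset.sum_nonneg fun j _ => hw j i
    · rw [LinearMap.sum_apply, hb, Finset.sum_eq_zero_iff_of_nonneg fun j _ => hw j i]
  have hba : ∀ A, CFace v A → b (a A) = A := by
    rintro A ⟨ψ, hψ, hA⟩
    ext i
    rw [hb]
    refine ⟨fun h => ?_, fun h j hj => (ha A j).1 hj i h⟩
    obtain ⟨c, hc, e⟩ := h2 ψ hψ
    rw [hA, e, LinearMap.sum_apply]
    refine Finset.sum_eq_zero fun φ hφ => ?_
    rw [LinearMap.smul_apply, smul_eq_mul]
    by_cases hc0 : c φ = 0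
    · simp [hc0]
    · have : (⟨φ, hφ⟩ : T) ∈ a A := by
        rw [ha]
        intro k hk
        have h3 := (hA k).1 hk
        rw [e, LinearMap.sum_apply, Finset.sum_eq_zero_iff_of_nonneg] at h3
        · have := h3 φ hφ
          rw [LinearMap.smul_apply, smul_eq_mul] at this
          exact (mul_eq_zero.1 this).resolve_left hc0
        · intro χ hχ
          exact mul_nonneg (hc χ) (hT χ hχ k)
      have := h _ this
      change c φ * φ (v i) = 0
      rw [show φ (v i) = 0 from this, mul_zero]
  have hab : ∀ B, CFace w B → a (b B) = B := by
    rintro B ⟨Φ, hΦ, hB⟩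
    ext j
    rw [ha]
    refine ⟨fun h => ?_, fun h i hi => (hb B i).1 hi j h⟩
    obtain ⟨x, hx⟩ := (Module.evalEquiv ℝ V).surjective Φ
    have hx' : ∀ φ, Φ φ = φ x := fun φ => by rw [← hx]; rfl
    simp only [hx'] at hΦ hB
    obtain ⟨c, hc, e⟩ := h1 x fun φ hφ => hΦ ⟨φ, hφ⟩
    rw [hB, e, map_sum]
    refine Finset.sum_eq_zero fun i _ => ?_
    rw [map_smul, smul_eq_mul]
    by_cases hc0 : c i = 0
    · simp [hc0]
    · have : i ∈ b B := by
        rw [hb]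
        intro k hk
        have h3 := (hB k).1 hk
        rw [e, map_sum, Finset.sum_eq_zero_iff_of_nonneg] at h3
        · have := h3 i (Finset.mem_univ i)
          rw [map_smul, smul_eq_mul] at this
          exact (mul_eq_zero.1 this).resolve_left hc0
        · intro m _
          rw [map_smul, smul_eq_mul]
          exact mul_nonneg (hc m) (hw k m)
      rw [h _ this, mul_zero]
  refine ⟨{ toFun := fun A => OrderDual.toDual ⟨a A.1, hfa A.1⟩
            invFun := fun B => ⟨b (OrderDual.ofDual B).1, hfb _⟩
            left_inv := fun A => Subtype.ext (hba A.1 A.2)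
            right_inv := fun B => by
              apply OrderDual.ofDual.injective
              exact Subtype.ext (hab _ (OrderDual.ofDual B).2)
            map_rel_iff' := ?_ }⟩
  intro A A'
  change a A'.1 ⊆ a A.1 ↔ A.1 ⊆ A'.1
  constructor
  · intro h
    rw [← hba A.1 A.2, ← hba A'.1 A'.2]
    intro i hi
    rw [hb] at hi ⊢
    exact fun j hj => hi j (h hj)
  · intro h j hj
    rw [ha] at hj ⊢
    exact fun i hi => hj i (h hi)

lemma cface_scale {ι V W : Type*} [Fintype ι] [AddCommGroup V] [Module ℝ V]
    [AddCommGroup W] [Module ℝ W] (N : V →ₗ[ℝ] W) (hN : LinearMap.ker N = ⊥) (c : ι → ℝ)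
    (hc : ∀ i, 0 < c i) (v : ι → V) (w : ι → W) (hw : ∀ i, w i = c i • N (v i)) (A : Finset ι) :
    CFace v A ↔ CFace w A := by
  obtain ⟨M, hM⟩ := LinearMap.exists_leftInverse_of_injective N hN
  have hM' : ∀ x, M (N x) = x := fun x => by
    rw [← LinearMap.comp_apply, hM, LinearMap.id_apply]
  constructor
  · rintro ⟨φ, h1, h2⟩
    refine ⟨φ ∘ₗ M, fun i => ?_, fun i => ?_⟩
    · simpa [hw, hM'] using mul_nonneg (hc i).le (h1 i)
    · simp [hw, hM', h2, (hc i).ne']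
  · rintro ⟨φ, h1, h2⟩
    refine ⟨φ ∘ₗ N, fun i => ?_, fun i => ?_⟩
    · have := h1 i
      rw [hw, map_smul, smul_eq_mul] at this
      exact nonneg_of_mul_nonneg_right this (hc i)
    · simp [hw, h2, (hc i).ne']

end Cfg

namespace Pol
open Cfg

variable {ι : Type*} [Fintype ι] {d : ℕ}

/-- Homogenization of a point configuration. -/
def hv (s : ι → Fin d → ℝ) (i : ι) : (Fin d → ℝ) × ℝ := (s i, 1)

/-- Convex hull of a subset of a point configuration. -/
def hull (s : ι → Fin d → ℝ) (A : Finset ι) : Set (Fin d → ℝ) :=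
  convexHull ℝ (s '' (A : Set ι))

lemma mem_hull (s : ι → Fin d → ℝ) (A : Finset ι) (x : Fin d → ℝ) :
    x ∈ hull s A ↔ ∃ c : ι → ℝ, (∀ i, 0 ≤ c i) ∧ (∀ i, i ∉ A → c i = 0) ∧ ∑ i, c i = 1 ∧
      ∑ i, c i • s i = x := by
  constructor
  · intro hx
    let K : Set (Fin d → ℝ) := {x | ∃ c : ι → ℝ, (∀ i, 0 ≤ c i) ∧ (∀ i, i ∉ A → c i = 0) ∧
      ∑ i, c i = 1 ∧ ∑ i, c i • s i = x}
    have hK : Convex ℝ K := by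
      rintro x ⟨c, h1, h2, h3, h4⟩ y ⟨c', h1', h2', h3', h4'⟩ a b ha hb hab
      refine ⟨fun i => a * c i + b * c' i, fun i => ?_, fun i hi => ?_, ?_, ?_⟩
      · have := h1 i; have := h1' i; positivity
      · simp [h2 i hi, h2' i hi]
      · rw [Finset.sum_add_distrib, ← Finset.mul_sum, ← Finset.mul_sum, h3, h3']; linarith
      · simp only [add_smul, mul_smul]
        rw [Finset.sum_add_distrib, ← Finset.smul_sum, ← Finset.smul_sum, h4, h4']
    refine convexHull_min ?_ hK hx
    rintro _ ⟨i, hi, rfl⟩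
    refine ⟨Pi.single i 1, fun j => ?_, fun j hj => ?_, ?_, ?_⟩
    · by_cases h : j = i
      · subst h; simp
      · simp [h]
    · have : j ≠ i := fun h => hj (h ▸ hi)
      simp [this]
    · simp
    · rw [Finset.sum_eq_single i] <;> simp +contextual
  · rintro ⟨c, h1, h2, h3, rfl⟩
    have e1 : ∑ i ∈ A, c i = 1 := by
      rw [← h3]
      exact Finset.sum_subset (Finset.subset_univ _) fun i _ hi => h2 i hi
    have e2 : ∑ i ∈ A, c i • s i = ∑ i, c i • s i :=
      Finset.sum_subset (Finset.subset_univ _) fun i _ hi => by rw [h2 i hi, zero_smul]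
    rw [← e2]
    exact (convex_convexHull ℝ _).sum_mem (fun i _ => h1 i) e1
      fun i hi => subset_convexHull ℝ _ ⟨i, hi, rfl⟩

lemma hull_mono (s : ι → Fin d → ℝ) {A B : Finset ι} (h : A ⊆ B) : hull s A ⊆ hull s B :=
  convexHull_mono (Set.image_mono h)

lemma lin_hv (s : ι → Fin d → ℝ) (φ : (Fin d → ℝ) × ℝ →ₗ[ℝ] ℝ) (c : ι → ℝ) (h : ∑ i, c i = 1) :
    φ (∑ i, c i • s i, 1) = ∑ i, c i * φ (hv s i) := by
  have : ((∑ i, c i • s i, 1) : (Fin d → ℝ) × ℝ) = ∑ i, c i • hv s i := by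
    ext j
    · simp [hv, Prod.fst_sum]
    · simp [hv, Prod.snd_sum, h]
  rw [this, map_sum]
  simp

lemma key (s : ι → Fin d → ℝ) (A D : Finset ι) (φ : (Fin d → ℝ) × ℝ →ₗ[ℝ] ℝ)
    (hφ : ∀ i ∈ A, 0 ≤ φ (hv s i)) (hD : ∀ i, i ∈ D ↔ i ∈ A ∧ φ (hv s i) = 0) :
    {x ∈ hull s A | φ (x, 1) = 0} = hull s D := by
  ext x
  constructor
  · rintro ⟨hx, h0⟩
    rw [mem_hull] at hx ⊢
    obtain ⟨c, h1, h2, h3, rfl⟩ := hx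
    refine ⟨c, h1, fun i hi => ?_, h3, rfl⟩
    by_cases hiA : i ∈ A
    · rw [lin_hv s φ c h3, Finset.sum_eq_zero_iff_of_nonneg] at h0
      · have := h0 i (Finset.mem_univ i)
        refine (mul_eq_zero.1 this).resolve_right fun h => hi ((hD i).2 ⟨hiA, h⟩)
      · intro j _
        by_cases hj : j ∈ A
        · exact mul_nonneg (h1 j) (hφ j hj)
        · rw [h2 j hj, zero_mul]
    · exact h2 i hiA
  · intro hx
    refine ⟨hull_mono s (fun i hi => ((hD i).1 hi).1) hx, ?_⟩
    rw [mem_hull] at hx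
    obtain ⟨c, h1, h2, h3, rfl⟩ := hx
    rw [lin_hv s φ c h3]
    refine Finset.sum_eq_zero fun i _ => ?_
    by_cases hi : i ∈ D
    · rw [((hD i).1 hi).2, mul_zero]
    · rw [h2 i hi, zero_mul]

lemma hull_empty (s : ι → Fin d → ℝ) : hull s ∅ = ∅ := by simp [hull]

lemma mem_of_cface {s : ι → Fin d → ℝ} {A : Finset ι} (hA : CFace (hv s) A) (i : ι) :
    s i ∈ hull s A ↔ i ∈ A := by
  obtain ⟨φ, h1, h2⟩ := hA
  constructor
  · intro h
    rw [← key s Finset.univ A φ (fun i _ => h1 i) (by simpa using h2)] at h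
    exact (h2 i).2 h.2
  · intro h
    exact subset_convexHull ℝ _ ⟨i, h, rfl⟩

lemma hull_subset_iff {s : ι → Fin d → ℝ} {A B : Finset ι}
    (hB : CFace (hv s) B) : hull s A ⊆ hull s B ↔ A ⊆ B := by
  refine ⟨fun h i hi => ?_, hull_mono s⟩
  exact (mem_of_cface hB i).1 (h (subset_convexHull ℝ _ ⟨i, hi, rfl⟩))

lemma cface_empty (s : ι → Fin d → ℝ) : CFace (hv s) ∅ :=
  ⟨LinearMap.snd ℝ _ _, fun i => by simp [hv], fun i => by simp [hv]⟩

lemma isFace_iff (s : ι → Fin d → ℝ) (F : Set (Fin d → ℝ)) :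
    IsFace (hull s Finset.univ) F ↔ ∃ A, CFace (hv s) A ∧ F = hull s A := by
  constructor
  · rintro (rfl | rfl | ⟨f, c, h1, rfl⟩)
    · exact ⟨∅, cface_empty s, (hull_empty s).symm⟩
    · exact ⟨Finset.univ, cface_univ _, rfl⟩
    · let φ : (Fin d → ℝ) × ℝ →ₗ[ℝ] ℝ := c • LinearMap.snd ℝ _ _ - f ∘ₗ LinearMap.fst ℝ _ _
      have hφ : ∀ x, φ (x, 1) = c - f x := fun x => by simp [φ]
      have hp : ∀ i, 0 ≤ φ (hv s i) := fun i => by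
        rw [hv, hφ]
        have := h1 (s i) (subset_convexHull ℝ _ ⟨i, by simp, rfl⟩)
        linarith
      refine ⟨Finset.univ.filter fun i => φ (hv s i) = 0, ⟨φ, hp, by simp⟩, ?_⟩
      refine Eq.trans ?_ (key s Finset.univ _ φ (fun i _ => hp i) (by simp))
      ext x
      change _ ∧ _ ↔ _ ∧ _
      rw [hφ, sub_eq_zero]
      exact and_congr_right fun _ => eq_comm
  · rintro ⟨A, ⟨φ, h1, h2⟩, rfl⟩
    have e : ∀ x, φ (x, 1) = φ (0, 1) - (-(φ ∘ₗ LinearMap.inl ℝ _ _)) x := fun x => by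
      simp only [LinearMap.neg_apply, LinearMap.comp_apply, LinearMap.inl_apply, sub_neg_eq_add,
        ← map_add]
      simp
    refine Or.inr (Or.inr ⟨-(φ ∘ₗ LinearMap.inl ℝ _ _), φ (0, 1), fun x hx => ?_, ?_⟩)
    · rw [← sub_nonneg, ← e]
      rw [mem_hull] at hx
      obtain ⟨c, k1, k2, k3, rfl⟩ := hx
      rw [lin_hv s φ c k3]
      exact Finset.sum_nonneg fun i _ => mul_nonneg (k1 i) (h1 i)
    · rw [← key s Finset.univ A φ (fun i _ => h1 i) (by simpa using h2)]
      ext x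
      change _ ∧ _ ↔ _ ∧ _
      rw [e, sub_eq_zero]
      exact and_congr_right fun _ => eq_comm

/-- Face lattice of a polytope versus that of the homogenized configuration. -/
def faceIso (s : ι → Fin d → ℝ) :
    {A : Finset ι // CFace (hv s) A} ≃o {F // IsFace (hull s Finset.univ) F} where
  toFun A := ⟨hull s A.1, (isFace_iff s _).2 ⟨A.1, A.2, rfl⟩⟩
  invFun F := ⟨((isFace_iff s _).1 F.2).choose, ((isFace_iff s _).1 F.2).choose_spec.1⟩
  left_inv A := by
    have h := ((isFace_iff s (hull s A.1)).1 ((isFace_iff s _).2 ⟨A.1, A.2, rfl⟩)).choose_spec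
    apply Subtype.ext
    apply Finset.Subset.antisymm
    · exact (hull_subset_iff A.2).1 h.2.ge
    · exact (hull_subset_iff h.1).1 h.2.le
  right_inv F := Subtype.ext ((isFace_iff s _).1 F.2).choose_spec.2.symm
  map_rel_iff' := by
    intro A B
    exact hull_subset_iff B.2

lemma pdim_hull (s : ι → Fin d → ℝ) (A : Finset ι) :
    pdim (hull s A) = (rk (hv s) A : ℤ) - 1 := by
  rcases A.eq_empty_or_nonempty with rfl | ⟨i₀, hi₀⟩
  · rw [hull_empty, pdim, if_pos rfl, rk, Finset.coe_empty, Set.image_empty,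
      Submodule.span_empty, finrank_bot]; simp
  · have hne : hull s A ≠ ∅ := fun h => by
      have : s i₀ ∈ hull s A := subset_convexHull ℝ _ ⟨i₀, hi₀, rfl⟩
      rw [h] at this; exact this
    rw [pdim, if_neg hne, hull, affineSpan_convexHull, direction_affineSpan,
      vectorSpan_eq_span_vsub_set_right ℝ (Set.mem_image_of_mem s hi₀)]
    set D := Submodule.span ℝ ((fun x => x -ᵥ s i₀) '' (s '' (A : Set ι))) with hD
    have e : Submodule.span ℝ (hv s '' (A : Set ι)) =
        D.map (LinearMap.inl ℝ (Fin d → ℝ) ℝ) ⊔ Submodule.span ℝ {hv s i₀} := by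
      apply le_antisymm
      · rw [Submodule.span_le]
        rintro _ ⟨i, hi, rfl⟩
        have : hv s i = LinearMap.inl ℝ (Fin d → ℝ) ℝ (s i -ᵥ s i₀) + hv s i₀ := by
          simp [hv]
        rw [this]
        refine Submodule.add_mem_sup (Submodule.mem_map_of_mem (Submodule.subset_span ?_))
          (Submodule.mem_span_singleton_self _)
        exact ⟨s i, ⟨i, hi, rfl⟩, rfl⟩
      · rw [sup_le_iff, Submodule.map_le_iff_le_comap, hD, Submodule.span_le]
        constructor
        · rintro _ ⟨_, ⟨i, hi, rfl⟩, rfl⟩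
          have : LinearMap.inl ℝ (Fin d → ℝ) ℝ (s i -ᵥ s i₀) = hv s i - hv s i₀ := by
            simp [hv]
          change LinearMap.inl ℝ (Fin d → ℝ) ℝ (s i -ᵥ s i₀) ∈ Submodule.span ℝ (hv s '' (A : Set ι))
          rw [this]
          exact Submodule.sub_mem _ (Submodule.subset_span ⟨i, hi, rfl⟩)
            (Submodule.subset_span ⟨i₀, hi₀, rfl⟩)
        · rw [Submodule.span_singleton_le_iff_mem]
          exact Submodule.subset_span ⟨i₀, hi₀, rfl⟩
    have hinf : D.map (LinearMap.inl ℝ (Fin d → ℝ) ℝ) ⊓ Submodule.span ℝ {hv s i₀} = ⊥ := by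
      rw [eq_bot_iff]
      rintro _ ⟨⟨x, -, rfl⟩, h2⟩
      obtain ⟨a, ha⟩ := Submodule.mem_span_singleton.1 h2
      have h3 := congrArg Prod.snd ha
      simp only [hv, Prod.smul_mk, smul_eq_mul, mul_one, LinearMap.inl_apply] at h3
      rw [Submodule.mem_bot, ← ha, h3, zero_smul]
    have h1 := Submodule.finrank_sup_add_finrank_inf_eq (D.map (LinearMap.inl ℝ (Fin d → ℝ) ℝ))
      (Submodule.span ℝ {hv s i₀})
    rw [hinf, finrank_bot, finrank_span_singleton,
      ← (Submodule.equivMapOfInjective (LinearMap.inl ℝ (Fin d → ℝ) ℝ)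
        LinearMap.inl_injective D).finrank_eq] at h1
    · rw [rk, e]
      omega
    · simp [hv]

lemma exists_rep {P : Set (Fin d → ℝ)} (hP : IsPolytope P) :
    ∃ S : Finset (Fin d → ℝ), P = hull (fun i : S => (i : Fin d → ℝ)) Finset.univ := by
  obtain ⟨S, rfl⟩ := hP
  exact ⟨S, by simp [hull]⟩

lemma isPolytope_hull (s : ι → Fin d → ℝ) (A : Finset ι) : IsPolytope (hull s A) :=
  ⟨A.image s, by simp [hull]⟩

lemma finite_faces {P : Set (Fin d → ℝ)} (hP : IsPolytope P) : {F | IsFace P F}.Finite := by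
  obtain ⟨S, rfl⟩ := exists_rep hP
  have : Finite {F : Set (Fin d → ℝ) |
      IsFace (hull (fun i : S => (i : Fin d → ℝ)) Finset.univ) F} :=
    Finite.of_equiv _ (faceIso (fun i : S => (i : Fin d → ℝ))).toEquiv
  exact Set.toFinite _

lemma face_polytope {P F : Set (Fin d → ℝ)} (hP : IsPolytope P) (hF : IsFace P F) :
    IsPolytope F := by
  obtain ⟨S, rfl⟩ := exists_rep hP
  obtain ⟨A, -, rfl⟩ := (isFace_iff _ _).1 hF
  exact isPolytope_hull _ _

lemma face_subset {P F : Set (Fin d → ℝ)} (hF : IsFace P F) : F ⊆ P := by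
  rcases hF with rfl | rfl | ⟨f, c, -, rfl⟩
  · simp
  · exact subset_rfl
  · exact fun x hx => hx.1

lemma face_trans_iff {P G E : Set (Fin d → ℝ)} (hP : IsPolytope P) (hG : IsFace P G) :
    IsFace G E ↔ IsFace P E ∧ E ⊆ G := by
  constructor
  · intro h
    refine ⟨?_, face_subset h⟩
    rcases h with rfl | rfl | ⟨f, c, h1, rfl⟩
    · exact Or.inl rfl
    · exact hG
    · obtain ⟨S, rfl⟩ := exists_rep hP
      obtain ⟨A, hA, rfl⟩ := (isFace_iff _ _).1 hG
      rw [isFace_iff]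
      set s : S → Fin d → ℝ := fun i => i
      let φ : (Fin d → ℝ) × ℝ →ₗ[ℝ] ℝ := c • LinearMap.snd ℝ _ _ - f ∘ₗ LinearMap.fst ℝ _ _
      have hφ : ∀ x, φ (x, 1) = c - f x := fun x => by simp [φ]
      have hp : ∀ i ∈ A, 0 ≤ φ (hv s i) := fun i hi => by
        rw [hv, hφ]
        have := h1 (s i) (subset_convexHull ℝ _ ⟨i, hi, rfl⟩)
        linarith
      refine ⟨A.filter fun i => φ (hv s i) = 0, ?_, ?_⟩
      · refine face_of_face hA (-φ) (fun i hi => ?_) fun i => ?_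
        · have := hp i hi
          simpa using this
        · simp
      · refine Eq.trans ?_ (key s A _ φ hp (by simp))
        ext x
        change _ ∧ _ ↔ _ ∧ _
        rw [hφ, sub_eq_zero]
        exact and_congr_right fun _ => eq_comm
  · rintro ⟨h, hE⟩
    rcases h with rfl | rfl | ⟨f, c, h1, rfl⟩
    · exact Or.inl rfl
    · exact Or.inr (Or.inl (hE.antisymm (face_subset hG)))
    · refine Or.inr (Or.inr ⟨f, c, fun x hx => h1 x (face_subset hG hx), ?_⟩)
      ext x
      exact ⟨fun h => ⟨hE h, h.2⟩, fun h => ⟨face_subset hG h.1, h.2⟩⟩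

lemma pdim_ge (P : Set (Fin d → ℝ)) : -1 ≤ pdim P := by
  unfold pdim; split_ifs <;> omega

lemma pdim_lt {P A B : Set (Fin d → ℝ)} (hP : IsPolytope P) (hA : IsFace P A) (hB : IsFace P B)
    (h : A ⊂ B) : pdim A < pdim B := by
  obtain ⟨S, rfl⟩ := exists_rep hP
  obtain ⟨A, hA', rfl⟩ := (isFace_iff _ _).1 hA
  replace hA := hA'
  clear hA'
  obtain ⟨B, hB', rfl⟩ := (isFace_iff _ _).1 hB
  replace hB := hB'
  clear hB'
  rw [pdim_hull, pdim_hull]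
  have : rk (hv fun i : S => (i : Fin d → ℝ)) A < rk (hv fun i : S => (i : Fin d → ℝ)) B := by
    refine rk_lt hA ?_
    rw [ssubset_iff_subset_not_subset] at h ⊢
    rwa [hull_subset_iff hA, hull_subset_iff hB] at h
  omega

lemma pdim_cover {P A B : Set (Fin d → ℝ)} (hP : IsPolytope P) (hA : IsFace P A) (hB : IsFace P B)
    (h : A ⊂ B) (hc : ∀ E, IsFace P E → A ⊂ E → E ⊆ B → E = B) : pdim B = pdim A + 1 := by
  obtain ⟨S, rfl⟩ := exists_rep hP
  obtain ⟨A, hA', rfl⟩ := (isFace_iff _ _).1 hA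
  replace hA := hA'
  clear hA'
  obtain ⟨B, hB', rfl⟩ := (isFace_iff _ _).1 hB
  replace hB := hB'
  clear hB'
  rw [pdim_hull, pdim_hull]
  have : rk (hv fun i : S => (i : Fin d → ℝ)) B = rk (hv fun i : S => (i : Fin d → ℝ)) A + 1 := by
    refine rk_cover hA hB ?_ fun D hD h1 h2 => ?_
    · rw [ssubset_iff_subset_not_subset] at h ⊢
      rwa [hull_subset_iff hA, hull_subset_iff hB] at h
    · have := hc (hull _ D) ((isFace_iff _ _).2 ⟨D, hD, rfl⟩) ?_ (hull_mono _ h2)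
      · exact h2.antisymm ((hull_subset_iff hD).1 this.ge)
      · rw [ssubset_iff_subset_not_subset] at h1 ⊢
        rwa [hull_subset_iff hA, hull_subset_iff hD]
  omega

lemma euler_pol {P A B : Set (Fin d → ℝ)} (hP : IsPolytope P) (hA : IsFace P A) (hB : IsFace P B)
    (h : A ⊂ B) (U : Finset (Set (Fin d → ℝ)))
    (hU : ∀ E, E ∈ U ↔ IsFace P E ∧ A ⊆ E ∧ E ⊆ B) :
    ∑ E ∈ U, (-1 : ℤ) ^ (pdim E + 1).toNat = 0 := by
  obtain ⟨S, rfl⟩ := exists_rep hP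
  obtain ⟨A, hA', rfl⟩ := (isFace_iff _ _).1 hA
  replace hA := hA'
  clear hA'
  obtain ⟨B, hB', rfl⟩ := (isFace_iff _ _).1 hB
  replace hB := hB'
  clear hB'
  have hAB : A ⊂ B := by
    rw [ssubset_iff_subset_not_subset] at h ⊢
    rwa [hull_subset_iff hA, hull_subset_iff hB] at h
  rw [← euler _ hA hB hAB]
  symm
  refine Finset.sum_bij (fun D _ => hull (fun i : S => (i : Fin d → ℝ)) D) ?_ ?_ ?_ ?_
  · intro D hD
    simp only [Finset.mem_filter, Finset.mem_univ, true_and] at hD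
    exact (hU _).2 ⟨(isFace_iff _ _).2 ⟨D, hD.1, rfl⟩, hull_mono _ hD.2.1, hull_mono _ hD.2.2⟩
  · intro D hD D' hD' e
    simp only [Finset.mem_filter, Finset.mem_univ, true_and] at hD hD'
    exact ((hull_subset_iff hD'.1).1 e.le).antisymm ((hull_subset_iff hD.1).1 e.ge)
  · intro E hE
    obtain ⟨h1, h2, h3⟩ := (hU E).1 hE
    obtain ⟨D, hD, rfl⟩ := (isFace_iff _ _).1 h1
    refine ⟨D, ?_, rfl⟩
    simp only [Finset.mem_filter, Finset.mem_univ, true_and]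
    exact ⟨hD, (hull_subset_iff hD).1 h2, (hull_subset_iff hB).1 h3⟩
  · intro D hD
    rw [pdim_hull]
    congr 1
    omega

/-- Order isomorphism between subtypes of equivalent predicates. -/
def subIso {α : Type*} [Preorder α] {p q : α → Prop} (h : ∀ a, p a ↔ q a) :
    {a // p a} ≃o {a // q a} :=
  { Equiv.subtypeEquivRight h with map_rel_iff' := Iff.rfl }

lemma isFace_empty_iff (G : Set (Fin d → ℝ)) : IsFace ∅ G ↔ G = ∅ := by
  constructor
  · rintro (h | h | ⟨f, c, -, rfl⟩)
    · exact h
    · exact h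
    · simp
  · exact Or.inl

lemma exists_proj {W : Type*} [AddCommGroup W] [Module ℝ W] [FiniteDimensional ℝ W]
    (e : W →ₗ[ℝ] ℝ) (he : e ≠ 0) (hfin : Module.finrank ℝ W ≤ d + 1) :
    ∃ L : W →ₗ[ℝ] (Fin d → ℝ), ∀ φ, L φ = 0 → e φ = 0 → φ = 0 := by
  have hker := Module.Dual.finrank_ker_add_one_of_ne_zero (f := e) he
  have hle : Module.finrank ℝ (LinearMap.ker e) ≤ Module.finrank ℝ (Fin d → ℝ) := by
    rw [Module.finrank_fin_fun]; omega
  obtain ⟨L₀, hL₀⟩ := finrank_le_iff_exists_linearMap.mp hle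
  obtain ⟨L, hL⟩ := LinearMap.exists_extend L₀
  refine ⟨L, fun φ h1 h2 => ?_⟩
  have h3 : L₀ ⟨φ, h2⟩ = 0 := by rw [← hL]; exact h1
  have h4 := hL₀ (h3.trans (map_zero L₀).symm)
  exact congrArg Subtype.val h4

/-- Existence of polar polytopes. -/
lemma exists_polar {Q : Set (Fin d → ℝ)} (hQ : IsPolytope Q) :
    ∃ R : Set (Fin d → ℝ), IsPolytope R ∧
      Nonempty ({G : Set (Fin d → ℝ) // IsFace Q G} ≃o
        ({G : Set (Fin d → ℝ) // IsFace R G})ᵒᵈ) := by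
  obtain ⟨S, rfl⟩ := exists_rep hQ
  set s : S → Fin d → ℝ := fun i => i with hs
  rcases S.eq_empty_or_nonempty with hS | hS
  · have e : hull s Finset.univ = ∅ := by
      have : IsEmpty S := Finset.isEmpty_coe_sort.2 hS
      simp [hull]
    rw [e]
    refine ⟨∅, ⟨∅, by simp⟩, ?_⟩
    have : Unique {G : Set (Fin d → ℝ) // IsFace ∅ G} :=
      { default := ⟨∅, Or.inl rfl⟩
        uniq := fun G => Subtype.ext ((isFace_empty_iff _).1 G.2) }
    have : Unique ({G : Set (Fin d → ℝ) // IsFace ∅ G})ᵒᵈ :=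
      { default := OrderDual.toDual ⟨∅, Or.inl rfl⟩
        uniq := fun G => Subtype.ext ((isFace_empty_iff _).1 (OrderDual.ofDual G).2) }
    exact ⟨OrderIso.ofUnique _ _⟩
  · let V := Submodule.span ℝ (Set.range (hv s))
    let v : S → V := fun i => ⟨hv s i, Submodule.subset_span ⟨i, rfl⟩⟩
    have hVv : ∀ A, CFace (hv s) A ↔ CFace v A := fun A =>
      (cface_scale V.subtype (Submodule.ker_subtype V) (fun _ => 1) (fun _ => one_pos) v (hv s)
        (fun i => by simp [v]) A).symm
    obtain ⟨T, hT0, hT1, hT2, hT3⟩ := exists_dual v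
    obtain ⟨I⟩ := dual_iso v T hT1 hT2 hT3
    let x₀ : V := ∑ i, v i
    have hx₀ : x₀ ≠ 0 := fun h => by
      have h2 : (x₀ : (Fin d → ℝ) × ℝ).2 = 0 := by rw [h]; rfl
      simp only [x₀, v, hv, Submodule.coe_sum, Prod.snd_sum] at h2
      simp at h2
      exact hS.ne_empty h2
    have hpos : ∀ j ∈ T, 0 < j x₀ := fun j hj => by
      have h0 : 0 ≤ j x₀ := by
        rw [map_sum]; exact Finset.sum_nonneg fun i _ => hT1 j hj i
      refine lt_of_le_of_ne h0 fun h => hT0 j hj ?_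
      rw [map_sum] at h
      have h1 := (Finset.sum_eq_zero_iff_of_nonneg fun i _ => hT1 j hj i).1 h.symm
      obtain ⟨j', hj'⟩ := LinearMap.exists_extend j
      have : V ≤ LinearMap.ker j' := by
        refine Submodule.span_le.2 ?_
        rintro _ ⟨i, rfl⟩
        have h3 := h1 i (Finset.mem_univ i)
        rw [← hj'] at h3
        exact h3
      ext x
      rw [← hj']
      exact this x.2
    have hfin : Module.finrank ℝ V ≤ d + 1 := by
      refine (Submodule.finrank_le V).trans ?_
      simp
    let e : Module.Dual ℝ (Module.Dual ℝ V) := Module.Dual.eval ℝ V x₀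
    have he : e ≠ 0 := fun h => hx₀ ((Module.evalEquiv ℝ V).injective (by
      rw [map_zero]; exact h))
    obtain ⟨L, hL⟩ := exists_proj (d := d) (W := V →ₗ[ℝ] ℝ) e he
      (le_trans (Subspace.dual_finrank_eq (K := ℝ) (V := V)).le hfin)
    let N : Module.Dual ℝ V →ₗ[ℝ] (Fin d → ℝ) × ℝ := L.prod e
    have hN : LinearMap.ker N = ⊥ := by
      rw [LinearMap.ker_eq_bot']
      intro φ hφ
      have h1 : L φ = 0 := congrArg Prod.fst hφ
      have h2 : e φ = 0 := congrArg Prod.snd hφ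
      exact hL φ h1 h2
    let t : T → Fin d → ℝ := fun j => ((j : Module.Dual ℝ V) x₀)⁻¹ • L j
    have ht : ∀ B, CFace (fun j : T => (j : Module.Dual ℝ V)) B ↔ CFace (hv t) B := fun B => by
      refine cface_scale N hN (fun j : T => ((j : Module.Dual ℝ V) x₀)⁻¹)
        (fun j => inv_pos.2 (hpos _ j.2)) _ _ (fun j => ?_) B
      have : (j : Module.Dual ℝ V) x₀ ≠ 0 := (hpos _ j.2).ne'
      refine Prod.ext rfl ?_
      change (1 : ℝ) = ((j : Module.Dual ℝ V) x₀)⁻¹ * (j : Module.Dual ℝ V) x₀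
      field_simp
    exact ⟨hull t Finset.univ, isPolytope_hull _ _,
      ⟨(faceIso s).symm.trans ((subIso hVv).trans (I.trans
        (((subIso ht).trans (faceIso t)).dual)))⟩⟩

end Pol

namespace Fin3
open Pol

variable {d : ℕ}

lemma rank_eq {α : Type*} [Finite α] [PartialOrder α] (r r' : α → ℤ)
    (h : ∀ x y, x ⋖ y → r y = r x + 1) (h' : ∀ x y, x ⋖ y → r' y = r' x + 1) {x y : α}
    (hxy : x ≤ y) : r y - r x = r' y - r' x := by
  have := Fintype.ofFinite α
  let _ : LocallyFiniteOrder α := Fintype.toLocallyFiniteOrder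
  rw [le_iff_reflTransGen_covBy] at hxy
  induction hxy with
  | refl => simp
  | tail _ hc ih =>
    have h1 := h _ _ hc
    have h2 := h' _ _ hc
    linarith

lemma model_cover {α : Type*} [PartialOrder α] {P : Set (Fin d → ℝ)} (hP : IsPolytope P)
    (a : α → Set (Fin d → ℝ)) (hf : ∀ x, IsFace P (a x)) (hm : ∀ x y, x ≤ y ↔ a x ⊆ a y)
    (hc : ∀ x y D, IsFace P D → a x ⊆ D → D ⊆ a y → ∃ z, a z = D) (x y : α) (h : x ⋖ y) :
    pdim (a y) = pdim (a x) + 1 := by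
  refine pdim_cover hP (hf x) (hf y) ?_ fun E hE h1 h2 => ?_
  · rw [ssubset_iff_subset_not_subset, ← hm, ← hm]
    exact lt_iff_le_not_ge.1 h.1
  · obtain ⟨z, rfl⟩ := hc x y E hE h1.1 h2
    rw [ssubset_iff_subset_not_subset, ← hm, ← hm] at h1
    rw [← hm] at h2
    rcases h2.lt_or_eq with h3 | h3
    · exact absurd h3 (h.2 (lt_iff_le_not_ge.2 h1))
    · rw [h3]

lemma mk_iso {α β γ : Type*} [PartialOrder α] [PartialOrder β] [PartialOrder γ]
    {q : β → Prop} {r : γ → Prop} (a : α → β) (b : α → γ)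
    (ha : ∀ x, q (a x)) (ha' : ∀ y, q y → ∃ x, a x = y) (hm : ∀ x y, x ≤ y ↔ a x ≤ a y)
    (hb : ∀ x, r (b x)) (hb' : ∀ y, r y → ∃ x, b x = y) (hn : ∀ x y, x ≤ y ↔ b y ≤ b x) :
    Nonempty ({y // q y} ≃o ({z // r z})ᵒᵈ) := by
  let e₁ : α ≃o {y // q y} := RelIso.ofSurjective
    (OrderEmbedding.ofMapLEIff (fun x => (⟨a x, ha x⟩ : {y // q y})) fun x y => (hm x y).symm)
    (fun y => (ha' y.1 y.2).imp fun x hx => Subtype.ext hx)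
  let e₂ : α ≃o ({z // r z})ᵒᵈ := RelIso.ofSurjective
    (OrderEmbedding.ofMapLEIff (fun x => OrderDual.toDual (⟨b x, hb x⟩ : {z // r z}))
      fun x y => (hn x y).symm)
    (fun y => (hb' (OrderDual.ofDual y).1 (OrderDual.ofDual y).2).imp fun x hx => by
      apply OrderDual.ofDual.injective
      exact Subtype.ext hx)
  exact ⟨e₁.symm.trans e₂⟩

/-- The consequence of the `g`-`h` recursion that is used. -/
lemma gh_core {g h : Set (Fin d → ℝ) → ℤ[X]} (hGH : IsGH g h) {R : Set (Fin d → ℝ)}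
    (hR : IsPolytope R) (hne : R ≠ ∅) {α : Type*} (W : Finset α) (a : α → Set (Fin d → ℝ))
    (hinj : ∀ x ∈ W, ∀ y ∈ W, a x = a y → x = y) (himg : ∀ D, IsFace R D ↔ ∃ z ∈ W, a z = D)
    (i : ℕ) (hi : 2 * (i : ℤ) ≤ pdim R) :
    (∑ z ∈ W, g (a z) * (X - 1) ^ (pdim R - pdim (a z)).toNat).coeff i = 0 := by
  obtain ⟨-, h2, h3⟩ := hGH
  have hh := h2 R hR
  obtain ⟨k1, k2, -⟩ := h3 R hR hne
  have hset : {F : Set (Fin d → ℝ) | IsFace R F ∧ F ≠ R} =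
      (((W.filter fun z => a z ≠ R).image a : Finset (Set (Fin d → ℝ))) : Set _) := by
    ext D
    simp only [Finset.coe_image, Finset.coe_filter, Set.mem_image, Set.mem_ofPred_eq, himg]
    constructor
    · rintro ⟨⟨z, hz, rfl⟩, h⟩
      exact ⟨z, ⟨hz, h⟩, rfl⟩
    · rintro ⟨z, ⟨hz, h⟩, rfl⟩
      exact ⟨⟨z, hz, rfl⟩, h⟩
  rw [hset, finsum_mem_coe_finset, Finset.sum_image (by
    intro x hx y hy e
    exact hinj x (Finset.mem_filter.1 hx).1 y (Finset.mem_filter.1 hy).1 e)] at hh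
  have key : ∑ z ∈ W, g (a z) * (X - 1 : ℤ[X]) ^ (pdim R - pdim (a z)).toNat =
      g R + (X - 1) * h R := by
    rw [← Finset.sum_filter_add_sum_filter_not W (fun z => a z = R)]
    congr 1
    · obtain ⟨z₀, hz₀, e⟩ := (himg R).1 (Or.inr (Or.inl rfl))
      rw [Finset.sum_eq_single z₀]
      · simp [e]
      · intro b hb hne
        rw [Finset.mem_filter] at hb
        exact absurd (hinj b hb.1 z₀ hz₀ (hb.2.trans e.symm)) hne
      · intro h
        exact absurd (Finset.mem_filter.2 ⟨hz₀, e⟩) h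
    · rw [hh, Finset.mul_sum]
      refine Finset.sum_congr rfl fun z hz => ?_
      rw [Finset.mem_filter] at hz
      have hf : IsFace R (a z) := (himg _).2 ⟨z, hz.1, rfl⟩
      have := pdim_lt hR hf (Or.inr (Or.inl rfl)) (ssubset_of_subset_of_ne (face_subset hf) hz.2)
      have e : (pdim R - pdim (a z)).toNat = (pdim R - pdim (a z) - 1).toNat + 1 := by omega
      rw [e, pow_succ]
      ring
  rw [key, coeff_add, sub_mul, coeff_sub, one_mul]
  rcases Nat.eq_zero_or_pos i with rfl | hpos
  · rw [k1]; simp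
  · rw [k2 i hpos hi]
    obtain ⟨j, rfl⟩ : ∃ j, i = j + 1 := ⟨i - 1, by omega⟩
    rw [coeff_X_mul]; simp

lemma gh_hi {g h : Set (Fin d → ℝ) → ℤ[X]} (hGH : IsGH g h) {R : Set (Fin d → ℝ)}
    (hR : IsPolytope R) (hne : R ≠ ∅) (i : ℕ) (hi : pdim R < 2 * (i : ℤ)) :
    (g R).coeff i = 0 := by
  refine (hGH.2.2 R hR hne).2.2 i ?_ (by omega)
  rw [pdim, if_neg hne] at hi
  omega

/-- The upper interval of the face lattice above `F`. -/
abbrev Up (P F : Set (Fin d → ℝ)) := {E : Set (Fin d → ℝ) // IsFace P E ∧ F ⊆ E}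

lemma finite_up {P : Set (Fin d → ℝ)} (hP : IsPolytope P) (F : Set (Fin d → ℝ)) :
    Finite (Up P F) :=
  ((finite_faces hP).subset fun _ h => h.1 : {E | IsFace P E ∧ F ⊆ E}.Finite)

lemma finsum_up {P F : Set (Fin d → ℝ)} [Fintype (Up P F)] (p : Set (Fin d → ℝ) → Prop)
    (hp : ∀ E, p E → IsFace P E ∧ F ⊆ E) (f : Set (Fin d → ℝ) → ℤ[X]) :
    ∑ᶠ E ∈ {E | p E}, f E = ∑ E : Up P F with p E.1, f E.1 := by
  have : {E | p E} = (((Finset.univ.filter fun E : Up P F => p E.1).image Subtype.val :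
      Finset (Set (Fin d → ℝ))) : Set _) := by
    ext E
    simp only [Finset.coe_image, Finset.coe_filter, Set.mem_image, Set.mem_ofPred_eq,
      Finset.mem_univ, true_and]
    exact ⟨fun h => ⟨⟨E, hp E h⟩, h, rfl⟩, fun ⟨z, h, e⟩ => e ▸ h⟩
  rw [this, finsum_mem_coe_finset, Finset.sum_image Subtype.val_injective.injOn]

section
variable {P F : Set (Fin d → ℝ)}
  {Q : Set (Fin d → ℝ) → Set (Fin d → ℝ)} {ψ : Set (Fin d → ℝ) → Set (Fin d → ℝ) → Set (Fin d → ℝ)}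

lemma psi_le
    (hQ : ∀ E, IsFace P E → F ⊆ E → IsQuotientPair P E (Q E) (ψ E))
    (x z z' : Up P F) (h : x ≤ z) (h' : x ≤ z') :
    z ≤ z' ↔ ψ x.1 z.1 ⊆ ψ x.1 z'.1 :=
  (hQ x.1 x.2.1 x.2.2).2.2 z.1 ⟨z.2.1, h⟩ z'.1 ⟨z'.2.1, h'⟩

lemma psi_face_Q
    (hQ : ∀ E, IsFace P E → F ⊆ E → IsQuotientPair P E (Q E) (ψ E))
    (x z : Up P F) (h : x ≤ z) : IsFace (Q x.1) (ψ x.1 z.1) :=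
  (hQ x.1 x.2.1 x.2.2).2.1.1 ⟨z.2.1, h⟩

lemma psi_surj_Q
    (hQ : ∀ E, IsFace P E → F ⊆ E → IsQuotientPair P E (Q E) (ψ E))
    (x : Up P F) (D : Set (Fin d → ℝ)) (h : IsFace (Q x.1) D) :
    ∃ z : Up P F, x ≤ z ∧ ψ x.1 z.1 = D := by
  obtain ⟨z, ⟨h1, h2⟩, h3⟩ := (hQ x.1 x.2.1 x.2.2).2.1.2.2 h
  exact ⟨⟨z, h1, x.2.2.trans h2⟩, h2, h3⟩

lemma psi_pol
    (hQ : ∀ E, IsFace P E → F ⊆ E → IsQuotientPair P E (Q E) (ψ E))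
    (x z : Up P F) (h : x ≤ z) : IsPolytope (ψ x.1 z.1) :=
  face_polytope (hQ x.1 x.2.1 x.2.2).1 (psi_face_Q hQ x z h)

lemma psi_self
    (hQ : ∀ E, IsFace P E → F ⊆ E → IsQuotientPair P E (Q E) (ψ E))
    (x : Up P F) : ψ x.1 x.1 = ∅ := by
  obtain ⟨z, h1, h2⟩ := psi_surj_Q hQ x ∅ (Or.inl rfl)
  have := (psi_le hQ x x z le_rfl h1).1 h1
  rw [h2] at this
  exact Set.subset_empty_iff.1 this

lemma psi_face
    (hQ : ∀ E, IsFace P E → F ⊆ E → IsQuotientPair P E (Q E) (ψ E))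
    (x y z : Up P F) (h : x ≤ z) (h' : z ≤ y) : IsFace (ψ x.1 y.1) (ψ x.1 z.1) :=
  (face_trans_iff (hQ x.1 x.2.1 x.2.2).1 (psi_face_Q hQ x y (h.trans h'))).2
    ⟨psi_face_Q hQ x z h, (psi_le hQ x z y h (h.trans h')).1 h'⟩

lemma psi_surj
    (hQ : ∀ E, IsFace P E → F ⊆ E → IsQuotientPair P E (Q E) (ψ E))
    (x y : Up P F) (hxy : x ≤ y) (D : Set (Fin d → ℝ)) (h : IsFace (ψ x.1 y.1) D) :
    ∃ z : Up P F, x ≤ z ∧ z ≤ y ∧ ψ x.1 z.1 = D := by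
  obtain ⟨h1, h2⟩ := (face_trans_iff (hQ x.1 x.2.1 x.2.2).1 (psi_face_Q hQ x y hxy)).1 h
  obtain ⟨z, h3, rfl⟩ := psi_surj_Q hQ x D h1
  exact ⟨z, h3, (psi_le hQ x z y h3 hxy).2 h2, rfl⟩

lemma psi_top
    (hQ : ∀ E, IsFace P E → F ⊆ E → IsQuotientPair P E (Q E) (ψ E))
    (x y : Up P F) (hy : ∀ z : Up P F, z ≤ y) : ψ x.1 y.1 = Q x.1 := by
  obtain ⟨z, h1, h2⟩ := psi_surj_Q hQ x (Q x.1) (Or.inr (Or.inl rfl))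
  apply Set.Subset.antisymm (face_subset (psi_face_Q hQ x y (hy x)))
  rw [← h2]
  exact (psi_le hQ x z y h1 (hy x)).1 (hy z)

lemma pdim_le' (hP : IsPolytope P)
    (hQ : ∀ E, IsFace P E → F ⊆ E → IsQuotientPair P E (Q E) (ψ E))
    (x y : Up P F) (h : x ≤ y) : pdim x.1 ≤ pdim y.1 := by
  rcases h.lt_or_eq with h | h
  · exact (pdim_lt hP x.2.1 y.2.1 h).le
  · rw [h]

lemma base_cover (hP : IsPolytope P)
    (hQ : ∀ E, IsFace P E → F ⊆ E → IsQuotientPair P E (Q E) (ψ E))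
    (x y : Up P F) (a b : Set.Icc x y) (h : a ⋖ b) :
    pdim b.1.1 = pdim a.1.1 + 1 := by
  refine model_cover hP (fun z : Set.Icc x y => z.1.1) (fun z => z.1.2.1) (fun _ _ => Iff.rfl)
    (fun u v D hD h1 h2 => ?_) a b h
  exact ⟨⟨⟨D, hD, u.1.2.2.trans h1⟩, le_trans u.2.1 h1, le_trans (show _ ≤ v.1 from h2) v.2.2⟩, rfl⟩

lemma psi_pdim (hP : IsPolytope P)
    (hQ : ∀ E, IsFace P E → F ⊆ E → IsQuotientPair P E (Q E) (ψ E))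
    (x y : Up P F) (hxy : x ≤ y) :
    pdim (ψ x.1 y.1) = pdim y.1 - pdim x.1 - 1 := by
  have := finite_up hP F
  have h := rank_eq (α := Set.Icc x y) (fun z => pdim z.1.1) (fun z => pdim (ψ x.1 z.1.1))
    (base_cover hP hQ x y)
    (model_cover (psi_pol hQ x y hxy) (fun z : Set.Icc x y => ψ x.1 z.1.1)
      (fun z => psi_face hQ x y z.1 z.2.1 z.2.2)
      (fun z z' => psi_le hQ x z.1 z'.1 z.2.1 z'.2.1)
      (fun u v D hD _ _ => by
        obtain ⟨z, h1, h2, h3⟩ := psi_surj hQ x y hxy D hD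
        exact ⟨⟨z, h1, h2⟩, h3⟩))
    (x := ⟨x, le_rfl, hxy⟩) (y := ⟨y, hxy, le_rfl⟩) hxy
  simp only [psi_self hQ] at h
  rw [show pdim (∅ : Set (Fin d → ℝ)) = -1 from if_pos rfl] at h
  linarith

/-- The polar polytope of an interval. -/
lemma exists_theta (hP : IsPolytope P)
    (hQ : ∀ E, IsFace P E → F ⊆ E → IsQuotientPair P E (Q E) (ψ E))
    (x y : Up P F) (hxy : x ≤ y) : ∃ (R : Set (Fin d → ℝ))
    (θ : Set.Icc x y → Set (Fin d → ℝ)), IsPolytope R ∧ (∀ z, IsFace R (θ z)) ∧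
      (∀ D, IsFace R D → ∃ z, θ z = D) ∧ (∀ z z', z ≤ z' ↔ θ z' ⊆ θ z) ∧
      (∀ z, pdim R - pdim (θ z) = pdim z.1.1 - pdim x.1) ∧
      pdim R = pdim y.1 - pdim x.1 - 1 ∧ θ ⟨x, le_rfl, hxy⟩ = R ∧ θ ⟨y, hxy, le_rfl⟩ = ∅ := by
  have := finite_up hP F
  obtain ⟨R, hR, ⟨I⟩⟩ := exists_polar (psi_pol hQ x y hxy)
  let θ : Set.Icc x y → Set (Fin d → ℝ) := fun z =>
    (OrderDual.ofDual (I ⟨ψ x.1 z.1.1, psi_face hQ x y z.1 z.2.1 z.2.2⟩)).1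
  have hf : ∀ z, IsFace R (θ z) := fun z => (OrderDual.ofDual (I _)).2
  have hs : ∀ D, IsFace R D → ∃ z, θ z = D := fun D hD => by
    obtain ⟨⟨E, hE⟩, h⟩ := I.surjective (OrderDual.toDual ⟨D, hD⟩)
    obtain ⟨z, h1, h2, rfl⟩ := psi_surj hQ x y hxy E hE
    refine ⟨⟨z, h1, h2⟩, ?_⟩
    simp only [θ]
    rw [h]
    rfl
  have hm : ∀ z z', z ≤ z' ↔ θ z' ⊆ θ z := fun z z' => by
    have h1 := psi_le hQ x z.1 z'.1 z.2.1 z'.2.1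
    have h2 := I.map_rel_iff (a := ⟨ψ x.1 z.1.1, psi_face hQ x y z.1 z.2.1 z.2.2⟩)
      (b := ⟨ψ x.1 z'.1.1, psi_face hQ x y z'.1 z'.2.1 z'.2.2⟩)
    exact Iff.trans h1 h2.symm
  have hx : θ ⟨x, le_rfl, hxy⟩ = R := by
    obtain ⟨z, hz⟩ := hs R (Or.inr (Or.inl rfl))
    apply Set.Subset.antisymm (face_subset (hf _))
    rw [← hz]
    exact (hm _ _).1 z.2.1
  have hy : θ ⟨y, hxy, le_rfl⟩ = ∅ := by
    obtain ⟨z, hz⟩ := hs ∅ (Or.inl rfl)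
    rw [← Set.subset_empty_iff, ← hz]
    exact (hm _ _).1 z.2.2
  have hr : ∀ z, pdim R - pdim (θ z) = pdim z.1.1 - pdim x.1 := fun z => by
    have h := rank_eq (α := Set.Icc x y) (fun z => pdim z.1.1) (fun z => - pdim (θ z))
      (base_cover hP hQ x y)
      (fun a b hab => by
        have := model_cover (α := (Set.Icc x y)ᵒᵈ) hR (fun z => θ (OrderDual.ofDual z))
          (fun z => hf _) (fun z z' => hm _ _)
          (fun u v D hD _ _ => hs D hD) (OrderDual.toDual b) (OrderDual.toDual a) hab.toDual
        simp only [OrderDual.ofDual_toDual] at this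
        linarith)
      (x := ⟨x, le_rfl, hxy⟩) (y := z) z.2.1
    simp only [hx] at h
    linarith
  refine ⟨R, θ, hR, hf, hs, hm, hr, ?_, hx, hy⟩
  have := hr ⟨y, hxy, le_rfl⟩
  rw [hy, show pdim (∅ : Set (Fin d → ℝ)) = -1 from if_pos rfl] at this
  linarith

end

end Fin3

/-- For every convex polytope `P` and face `F` of `P`,
`g(P,F) = ∑_{F ≤ F′ ≤ P} (−1)^{dim P − dim F′} g(F′)·ḡ(P/F′)`, where
`ḡ(Q) = g(Q*)` is the `g`-polynomial of the polar polytope (characterized here by: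
`gbar Q = g R` whenever the face poset of `R` is anti-isomorphic to that of `Q`),
and `Q E` is a quotient polytope `P/E`. -/
theorem relative_g_inversion {d : ℕ} (g h : Set (Fin d → ℝ) → Polynomial ℤ)
    (gr : Set (Fin d → ℝ) → Set (Fin d → ℝ) → Polynomial ℤ)
    (gbar : Set (Fin d → ℝ) → Polynomial ℤ)
    (hGH : IsGH g h) (hgr : IsRelG g gr)
    (hbar : ∀ Q R : Set (Fin d → ℝ), IsPolytope Q → IsPolytope R →
      Nonempty ({G : Set (Fin d → ℝ) // IsFace Q G} ≃o
        ({G : Set (Fin d → ℝ) // IsFace R G})ᵒᵈ) →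
      gbar Q = g R)
    (P F : Set (Fin d → ℝ)) (hP : IsPolytope P) (hF : IsFace P F)
    (Q : Set (Fin d → ℝ) → Set (Fin d → ℝ))
    (ψ : Set (Fin d → ℝ) → Set (Fin d → ℝ) → Set (Fin d → ℝ))
    (hQ : ∀ E, IsFace P E → F ⊆ E → IsQuotientPair P E (Q E) (ψ E)) :
    gr P F = ∑ᶠ E ∈ {E : Set (Fin d → ℝ) | IsFace P E ∧ F ⊆ E},
      (-1 : Polynomial ℤ) ^ (pdim P - pdim E).toNat * g E * gbar (Q E) := by
  classical
  have hfin := Fin3.finite_up hP F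
  have : Fintype (Fin3.Up P F) := Fintype.ofFinite _
  let l : Fin3.Up P F → Fin3.Up P F → ℕ := fun x y => (pdim y.1 - pdim x.1).toNat
  have hle := Fin3.pdim_le' hP hQ
  have hlt : ∀ x y : Fin3.Up P F, x < y → pdim x.1 < pdim y.1 := fun x y h =>
    Pol.pdim_lt hP x.2.1 y.2.1 h
  have hadd : ∀ x y z, x ≤ y → y ≤ z → l x z = l x y + l y z := fun x y z h1 h2 => by
    have := hle _ _ h1
    have := hle _ _ h2
    simp only [l]
    omega
  have heul : ∀ x y, x < y → ∑ z with x ≤ z ∧ z ≤ y, (-1 : ℤ) ^ (l z y) = 0 := by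
    intro x y hxy
    have h1 := Pol.euler_pol hP x.2.1 y.2.1 hxy
      ((Finset.univ.filter fun z : Fin3.Up P F => x ≤ z ∧ z ≤ y).image Subtype.val) (fun E => by
        simp only [Finset.mem_image, Finset.mem_filter, Finset.mem_univ, true_and]
        constructor
        · rintro ⟨z, hz, rfl⟩
          exact ⟨z.2.1, hz⟩
        · rintro ⟨h1, h2, h3⟩
          exact ⟨⟨E, h1, x.2.2.trans h2⟩, ⟨h2, h3⟩, rfl⟩)
    rw [Finset.sum_image Subtype.val_injective.injOn] at h1
    have h2 : ∀ z ∈ Finset.univ.filter fun z : Fin3.Up P F => x ≤ z ∧ z ≤ y,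
        (-1 : ℤ) ^ (l z y) = (-1) ^ (pdim y.1 + 1).toNat * (-1) ^ (pdim z.1 + 1).toNat := by
      intro z hz
      have hz := (Finset.mem_filter.1 hz).2
      have h3 := hle _ _ hz.2
      have h4 := Pol.pdim_ge z.1
      have e : (pdim y.1 + 1).toNat = l z y + (pdim z.1 + 1).toNat := by
        simp only [l]; omega
      rw [e, pow_add, mul_assoc, ← pow_add, ← two_mul]
      simp
    rw [Finset.sum_congr rfl h2, ← Finset.mul_sum, h1, mul_zero]
  let G : Matrix (Fin3.Up P F) (Fin3.Up P F) ℤ[X] := fun x y => if x ≤ y then g (ψ x.1 y.1) else 0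
  let G' : Matrix (Fin3.Up P F) (Fin3.Up P F) ℤ[X] :=
    fun x y => if x ≤ y then gbar (ψ x.1 y.1) else 0
  have hG : ∀ x y, x ≤ y → G x y = g (ψ x.1 y.1) := fun x y h => if_pos h
  have hG' : ∀ x y, x ≤ y → G' x y = gbar (ψ x.1 y.1) := fun x y h => if_pos h
  have h0 : pdim (∅ : Set (Fin d → ℝ)) = -1 := if_pos rfl
  have hnon : ∀ R : Set (Fin d → ℝ), 0 ≤ pdim R → R ≠ ∅ := by
    rintro R h rfl
    rw [h0] at h
    omega
  have hdiag : ∀ x, G x x = 1 := fun x => by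
    rw [hG x x le_rfl, Fin3.psi_self hQ, hGH.1]
  have hhi : ∀ x y, x < y → ∀ i, l x y ≤ 2 * i → (G x y).coeff i = 0 := by
    intro x y hxy i hi
    rw [hG x y hxy.le]
    have h1 := Fin3.psi_pdim hP hQ x y hxy.le
    have h2 := hlt x y hxy
    simp only [l] at hi
    exact Fin3.gh_hi hGH (Fin3.psi_pol hQ x y hxy.le) (hnon _ (by omega)) i (by omega)
  have htri_of : ∀ M : Matrix (Fin3.Up P F) (Fin3.Up P F) ℤ[X], (∀ x y, ¬ x ≤ y → M x y = 0) →
      (∀ x, M x x = 1) → (∀ x y, x < y → ∀ i, l x y ≤ 2 * i → (M x y).coeff i = 0) →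
      KLS.Tri l M := by
    intro M h1 h2 h3 x y
    refine ⟨h1 x y, ?_⟩
    by_cases hxy : x ≤ y
    · rcases hxy.lt_or_eq with h | h
      · rw [natDegree_le_iff_coeff_eq_zero]
        intro N hN
        exact h3 x y h N (by omega)
      · subst h
        rw [h2]; simp
    · rw [h1 x y hxy]; simp
  have hlo : ∀ x y, x < y → ∀ i, 2 * i < l x y →
      ((G * KLS.Ker l (X - 1)) x y).coeff i = 0 := by
    intro x y hxy i hi
    have h1 := Fin3.psi_pdim hP hQ x y hxy.le
    have h2 := hlt x y hxy
    simp only [l] at hi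
    have h3 := Fin3.gh_core hGH (Fin3.psi_pol hQ x y hxy.le) (hnon _ (by omega))
      (Finset.univ.filter fun z : Fin3.Up P F => x ≤ z ∧ z ≤ y) (fun z => ψ x.1 z.1)
      (fun z hz z' hz' e => by
        simp only [Finset.mem_filter, Finset.mem_univ, true_and] at hz hz'
        exact le_antisymm ((Fin3.psi_le hQ x z z' hz.1 hz'.1).2 e.le)
          ((Fin3.psi_le hQ x z' z hz'.1 hz.1).2 e.ge))
      (fun D => by
        simp only [Finset.mem_filter, Finset.mem_univ, true_and]
        constructor
        · intro hD
          obtain ⟨z, h1, h2, h3⟩ := Fin3.psi_surj hQ x y hxy.le D hD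
          exact ⟨z, ⟨h1, h2⟩, h3⟩
        · rintro ⟨z, hz, rfl⟩
          exact Fin3.psi_face hQ x y z hz.1 hz.2) i (by omega)
    rw [← h3, Matrix.mul_apply, Finset.sum_filter]
    congr 1
    refine Finset.sum_congr rfl fun z _ => ?_
    by_cases hz : x ≤ z ∧ z ≤ y
    · rw [if_pos hz, hG x z hz.1, KLS.Ker, if_pos hz.2, h1, Fin3.psi_pdim hP hQ x z hz.1]
      congr 2
      simp only [l]
      omega
    · rw [if_neg hz]
      by_cases hxz : x ≤ z
      · have : ¬ z ≤ y := fun h => hz ⟨hxz, h⟩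
        rw [KLS.Ker, if_neg this, mul_zero]
      · have : G x z = 0 := if_neg hxz
        rw [this, zero_mul]
  -- the dual side
  have hface : ∀ (x y : Fin3.Up P F) (hxy : x ≤ y) (R : Set (Fin d → ℝ))
      (θ : Set.Icc x y → Set (Fin d → ℝ)), IsPolytope R → (∀ z, IsFace R (θ z)) →
      (∀ D, IsFace R D → ∃ z, θ z = D) → (∀ z z', z ≤ z' ↔ θ z' ⊆ θ z) →
      ∀ z : Set.Icc x y, gbar (ψ z.1.1 y.1) = g (θ z) := by
    intro x y hxy R θ hR hf hs hm z
    refine hbar _ _ (Fin3.psi_pol hQ z.1 y z.2.2) (Pol.face_polytope hR (hf z)) ?_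
    refine Fin3.mk_iso (α := Set.Icc z.1 y) (fun u => ψ z.1.1 u.1.1)
      (fun u => θ ⟨u.1, z.2.1.trans u.2.1, u.2.2⟩) ?_ ?_ ?_ ?_ ?_ ?_
    · intro u
      exact Fin3.psi_face hQ z.1 y u.1 u.2.1 u.2.2
    · intro D hD
      obtain ⟨u, h1, h2, h3⟩ := Fin3.psi_surj hQ z.1 y z.2.2 D hD
      exact ⟨⟨u, h1, h2⟩, h3⟩
    · intro u v
      exact Fin3.psi_le hQ z.1 u.1 v.1 u.2.1 v.2.1
    · intro u
      rw [Pol.face_trans_iff hR (hf z)]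
      exact ⟨hf _, (hm _ _).1 u.2.1⟩
    · intro D hD
      rw [Pol.face_trans_iff hR (hf z)] at hD
      obtain ⟨u, rfl⟩ := hs D hD.1
      exact ⟨⟨u.1, (hm z u).2 hD.2, u.2.2⟩, rfl⟩
    · intro u v
      exact hm ⟨u.1, z.2.1.trans u.2.1, u.2.2⟩ ⟨v.1, z.2.1.trans v.2.1, v.2.2⟩
  have hdiag' : ∀ x, G' x x = 1 := fun x => by
    rw [hG' x x le_rfl]
    obtain ⟨R, θ, hR, hf, hs, hm, hr, hd, hx, hy⟩ := Fin3.exists_theta hP hQ x x le_rfl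
    rw [hface x x le_rfl R θ hR hf hs hm ⟨x, le_rfl, le_rfl⟩, hy, hGH.1]
  have hhi' : ∀ x y, x < y → ∀ i, l x y ≤ 2 * i → (G' x y).coeff i = 0 := by
    intro x y hxy i hi
    rw [hG' x y hxy.le]
    obtain ⟨R, θ, hR, hf, hs, hm, hr, hd, hx, hy⟩ := Fin3.exists_theta hP hQ x y hxy.le
    have h2 := hlt x y hxy
    simp only [l] at hi
    rw [hface x y hxy.le R θ hR hf hs hm ⟨x, le_rfl, hxy.le⟩, hx]
    exact Fin3.gh_hi hGH hR (hnon _ (by omega)) i (by omega)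
  have hlo' : ∀ x y, x < y → ∀ i, 2 * i < l x y →
      ((KLS.Ker l (X - 1) * G') x y).coeff i = 0 := by
    intro x y hxy i hi
    obtain ⟨R, θ, hR, hf, hs, hm, hr, hd, hx, hy⟩ := Fin3.exists_theta hP hQ x y hxy.le
    have h2 := hlt x y hxy
    simp only [l] at hi
    have h3 := Fin3.gh_core hGH hR (hnon _ (by omega)) (Finset.univ : Finset (Set.Icc x y)) θ
      (fun z _ z' _ e => le_antisymm ((hm _ _).2 e.ge) ((hm _ _).2 e.le))
      (fun D => ⟨fun hD => (hs D hD).imp fun z hz => ⟨Finset.mem_univ _, hz⟩, by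
        rintro ⟨z, -, rfl⟩
        exact hf z⟩) i (by omega)
    rw [← h3, Matrix.mul_apply]
    congr 1
    have h4 : ∀ z : Fin3.Up P F, z ∉ (Finset.univ.filter fun z => z ∈ Set.Icc x y) →
        KLS.Ker l (X - 1) x z * G' z y = 0 := by
      intro z hz
      simp only [Finset.mem_filter, Finset.mem_univ, true_and] at hz
      by_cases hxz : x ≤ z
      · have : G' z y = 0 := if_neg fun h => hz ⟨hxz, h⟩
        rw [this, mul_zero]
      · rw [KLS.Ker, if_neg hxz, zero_mul]
    rw [← Finset.sum_subset (Finset.subset_univ (Finset.univ.filter fun z => z ∈ Set.Icc x y))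
      (fun z _ hz => h4 z hz)]
    rw [Finset.sum_subtype (p := fun z => z ∈ Set.Icc x y) _ (fun z => by simp)]
    refine Finset.sum_congr rfl fun z _ => ?_
    rw [hr z, KLS.Ker, if_pos z.2.1, hG' _ _ z.2.2, hface x y hxy.le R θ hR hf hs hm z, mul_comm]
  have hinv : G * KLS.Tw l G' = 1 := by
    convert KLS.kls_inverse hadd heul (htri_of G (fun x y h => if_neg h) hdiag hhi) hdiag hhi hlo
      (htri_of G' (fun x y h => if_neg h) hdiag' hhi') hdiag' hhi' hlo'
  -- the defining relation of the relative g-polynomials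
  have hrel : ∀ y : Fin3.Up P F, ∑ E : Fin3.Up P F, gr E.1 F * G E y = g y.1 := by
    intro y
    have hypol := Pol.face_polytope hP y.2.1
    have h1 := hgr y.1 F (fun E => ψ E y.1) ψ hypol
      ((Pol.face_trans_iff hP y.2.1).2 ⟨hF, y.2.2⟩) (by
        intro E hE hFE
        obtain ⟨hE1, hE2⟩ := (Pol.face_trans_iff hP y.2.1).1 hE
        let x : Fin3.Up P F := ⟨E, hE1, hFE⟩
        have hxy : x ≤ y := hE2
        have hsub : {G | IsFace y.1 G ∧ E ⊆ G} ⊆ {G | IsFace P G ∧ E ⊆ G} := fun A hA =>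
          ⟨((Pol.face_trans_iff hP y.2.1).1 hA.1).1, hA.2⟩
        refine ⟨Fin3.psi_pol hQ x y hxy, ⟨?_, ?_, ?_⟩, ?_⟩
        · intro A hA
          exact Fin3.psi_face hQ x y ⟨A, (hsub hA).1, hFE.trans hA.2⟩ hA.2
            ((Pol.face_trans_iff hP y.2.1).1 hA.1).2
        · exact (hQ E hE1 hFE).2.1.2.1.mono hsub
        · intro D hD
          obtain ⟨z, h1, h2, h3⟩ := Fin3.psi_surj hQ x y hxy D hD
          exact ⟨z.1, ⟨(Pol.face_trans_iff hP y.2.1).2 ⟨z.2.1, h2⟩, h1⟩, h3⟩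
        · intro A hA B hB
          exact (hQ E hE1 hFE).2.2 A (hsub hA) B (hsub hB))
    rw [Fin3.finsum_up (P := P) (F := F) (fun E => IsFace y.1 E ∧ F ⊆ E) (fun E hE =>
      ⟨((Pol.face_trans_iff hP y.2.1).1 hE.1).1, hE.2⟩), Finset.sum_filter] at h1
    rw [← h1]
    refine Finset.sum_congr rfl fun E _ => ?_
    by_cases hE : E ≤ y
    · rw [if_pos ⟨(Pol.face_trans_iff hP y.2.1).2 ⟨E.2.1, hE⟩, E.2.2⟩, hG E y hE]
    · have : G E y = 0 := if_neg hE
      rw [if_neg, this, mul_zero]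
      exact fun h => hE (Pol.face_subset h.1)
  let r : Fin3.Up P F → ℤ[X] := fun E => gr E.1 F
  have hvec : Matrix.vecMul r G = fun y => g y.1 := by
    funext y
    exact hrel y
  have hfinal : r = Matrix.vecMul (fun y : Fin3.Up P F => g y.1) (KLS.Tw l G') := by
    rw [← hvec, Matrix.vecMul_vecMul, hinv, Matrix.vecMul_one]
  let p : Fin3.Up P F := ⟨P, Or.inr (Or.inl rfl), Pol.face_subset hF⟩
  have hp : ∀ z : Fin3.Up P F, z ≤ p := fun z => Pol.face_subset z.2.1
  have h1 := congrFun hfinal p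
  rw [Fin3.finsum_up (P := P) (F := F) (fun E => IsFace P E ∧ F ⊆ E) (fun E hE => hE)]
  refine h1.trans ?_
  rw [Finset.sum_filter]
  refine Finset.sum_congr rfl fun E _ => ?_
  change g E.1 * ((-1) ^ (l E p) * G' E p) = _
  rw [if_pos E.2, hG' E p (hp E), Fin3.psi_top hQ E p hp]
  ring

end
end

section
/- Let P ⊆ ℝ^d be a d-dimensional convex polytope, F a face of P with dim F = k, and let L be an affine subspace of ℝ^d of dimension d−k−1 whose intersection with P is exactly one point, lying in the relative interior of F. Then for every sufficiently small translate L′ of L meeting the interior of P, the set P/F = P ∩ L′ is a (d−k−1)-dimensional convex polytope, and its face poset is order-isomorphic to the interval [F,P] = { E ∈ 𝓕(P) : F ≤ E ≤ P }, via the map sending a nonempty face G of P/F to the smallest face of P containing G and sending ∅ to F. -/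
open Polynomial
open scoped Classical

noncomputable section

section Helpers

/-- Farkas' lemma, by Bartl's induction. -/
theorem qp_farkas {E ι : Type*} [AddCommGroup E] [Module ℝ E] (s : Finset ι) :
    ∀ (a : ι → E) (b : E),
      (∃ w : ι → ℝ, (∀ i ∈ s, 0 ≤ w i) ∧ b = ∑ i ∈ s, w i • a i) ∨
      ∃ f : E →ₗ[ℝ] ℝ, (∀ i ∈ s, 0 ≤ f (a i)) ∧ f b < 0 := by
  induction s using Finset.induction_on with
  | empty =>
    intro a b
    by_cases hb : b = 0
    · left; exact ⟨0, by simp, by simp [hb]⟩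
    · right
      have hfb : ∃ g : E →ₗ[ℝ] ℝ, g b ≠ 0 := by
        by_contra h
        push Not at h
        exact hb ((Module.forall_dual_apply_eq_zero_iff ℝ b).1 h)
      obtain ⟨g, hg⟩ := hfb
      rcases lt_or_gt_of_ne hg with h | h
      · exact ⟨g, by simp, h⟩
      · exact ⟨-g, by simp, by simpa using h⟩
  | insert i₀ s hi₀ ih =>
    intro a b
    rcases ih a b with ⟨w, hw, hb⟩ | ⟨f, hf, hfb⟩
    · left
      refine ⟨Function.update w i₀ 0, ?_, ?_⟩
      · intro i hi
        by_cases h : i = i₀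
        · subst h; simp
        · rw [Function.update_of_ne h]
          exact hw i ((Finset.mem_insert.1 hi).resolve_left h)
      · rw [Finset.sum_insert hi₀, Function.update_self, zero_smul, zero_add, hb]
        refine Finset.sum_congr rfl fun i hi => ?_
        rw [Function.update_of_ne (ne_of_mem_of_not_mem hi hi₀)]
    · by_cases h0 : 0 ≤ f (a i₀)
      · right
        refine ⟨f, ?_, hfb⟩
        intro i hi
        rcases Finset.mem_insert.1 hi with rfl | hi
        · exact h0
        · exact hf i hi
      push Not at h0
      rcases ih (fun i => a i - (f (a i) / f (a i₀)) • a i₀) (b - (f b / f (a i₀)) • a i₀) with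
        ⟨w, hw, hb⟩ | ⟨g, hg, hgb⟩
      · left
        refine ⟨Function.update w i₀ (f b / f (a i₀) - ∑ i ∈ s, w i * (f (a i) / f (a i₀))), ?_, ?_⟩
        · intro i hi
          by_cases h : i = i₀
          · subst h
            rw [Function.update_self]
            have h1 : 0 ≤ f b / f (a i) := div_nonneg_of_nonpos hfb.le h0.le
            have h2 : ∑ j ∈ s, w j * (f (a j) / f (a i)) ≤ 0 := by
              refine Finset.sum_nonpos fun j hj => ?_
              exact mul_nonpos_of_nonneg_of_nonpos (hw j hj)
                (div_nonpos_of_nonneg_of_nonpos (hf j hj) h0.le)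
            linarith
          · rw [Function.update_of_ne h]
            exact hw i ((Finset.mem_insert.1 hi).resolve_left h)
        · rw [Finset.sum_insert hi₀, Function.update_self]
          have h3 : ∑ i ∈ s, Function.update w i₀
              (f b / f (a i₀) - ∑ i ∈ s, w i * (f (a i) / f (a i₀))) i • a i
              = ∑ i ∈ s, w i • a i :=
            Finset.sum_congr rfl fun i hi => by
              rw [Function.update_of_ne (ne_of_mem_of_not_mem hi hi₀)]
          rw [h3]
          simp only [smul_sub, Finset.sum_sub_distrib, smul_smul] at hb
          rw [← Finset.sum_smul] at hb
          rw [sub_smul]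
          rw [sub_eq_iff_eq_add] at hb
          refine hb.trans ?_
          abel
      · right
        refine ⟨g - (g (a i₀) / f (a i₀)) • f, ?_, ?_⟩
        · intro i hi
          rcases Finset.mem_insert.1 hi with rfl | hi
          · simp only [LinearMap.sub_apply, LinearMap.smul_apply, smul_eq_mul]
            rw [div_mul_cancel₀ _ h0.ne]; simp
          · have := hg i hi
            simp only [map_sub, map_smul, smul_eq_mul] at this
            simp only [LinearMap.sub_apply, LinearMap.smul_apply, smul_eq_mul]
            convert this using 1; ring
        · simp only [map_sub, map_smul, smul_eq_mul] at hgb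
          simp only [LinearMap.sub_apply, LinearMap.smul_apply, smul_eq_mul]
          convert hgb using 1; ring

variable {d : ℕ}

/-- Algebraic relative interior. -/
def QPri (A : Set (Fin d → ℝ)) : Set (Fin d → ℝ) :=
  {x | x ∈ A ∧ ∀ y ∈ A, ∃ t : ℝ, 0 < t ∧ x + t • (x - y) ∈ A}

theorem qp_face_subset {P F : Set (Fin d → ℝ)} (h : IsFace P F) : F ⊆ P := by
  rcases h with rfl | rfl | ⟨f, c, _, rfl⟩
  · exact Set.empty_subset _
  · exact le_rfl
  · exact fun x hx => hx.1

theorem qp_face_of_ri {P E A : Set (Fin d → ℝ)} (hE : IsFace P E) (hA : A ⊆ P)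
    {x : Fin d → ℝ} (hx : x ∈ QPri A) (hxE : x ∈ E) : A ⊆ E := by
  rcases hE with rfl | rfl | ⟨f, c, hf, rfl⟩
  · exact hxE.elim
  · exact hA
  · intro y hy
    obtain ⟨t, ht, hty⟩ := hx.2 y hy
    refine ⟨hA hy, le_antisymm (hf y (hA hy)) ?_⟩
    have h1 := hf _ (hA hty)
    have h2 := hxE.2
    simp only [map_add, map_smul, map_sub, smul_eq_mul, h2] at h1
    have : t * (c - f y) ≤ 0 := by linarith
    nlinarith

theorem qp_filter_hull (S : Finset (Fin d → ℝ)) (f : (Fin d → ℝ) →ₗ[ℝ] ℝ) (c : ℝ)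
    (hf : ∀ s ∈ S, f s ≤ c) :
    {x ∈ convexHull ℝ (S : Set (Fin d → ℝ)) | f x = c} ⊆
      convexHull ℝ ({s | s ∈ S ∧ f s = c} : Set (Fin d → ℝ)) := by
  rintro x ⟨hx, hfx⟩
  rw [Finset.mem_convexHull'] at hx
  obtain ⟨w, hw0, hw1, rfl⟩ := hx
  have hsum : ∑ s ∈ S, w s * (c - f s) = 0 := by
    simp only [mul_sub, Finset.sum_sub_distrib, ← Finset.sum_mul, hw1]
    simp only [map_sum, map_smul, smul_eq_mul] at hfx
    linarith
  rw [Finset.sum_eq_zero_iff_of_nonneg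
    (fun s hs => mul_nonneg (hw0 s hs) (sub_nonneg.2 (hf s hs)))] at hsum
  have hz : ∀ s ∈ S, ¬ (f s = c) → w s = 0 := by
    intro s hs hne
    rcases mul_eq_zero.1 (hsum s hs) with h | h
    · exact h
    · exact (hne (by linarith)).elim
  rw [← Finset.sum_filter_add_sum_filter_not S (fun s => f s = c)]
  rw [← Finset.sum_filter_add_sum_filter_not S (fun s => f s = c)] at hw1
  rw [Finset.sum_eq_zero (s := S.filter (fun s => ¬ f s = c)) (fun s hs => hz s (Finset.mem_filter.1 hs).1 (Finset.mem_filter.1 hs).2)] at hw1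
  rw [Finset.sum_eq_zero (s := S.filter (fun s => ¬ f s = c)) (fun s hs => by
    rw [hz s (Finset.mem_filter.1 hs).1 (Finset.mem_filter.1 hs).2, zero_smul])]
  rw [add_zero] at hw1 ⊢
  refine (convex_convexHull ℝ _).sum_mem (fun s hs => hw0 s (Finset.mem_filter.1 hs).1) hw1 ?_
  intro s hs
  exact subset_convexHull ℝ _ (Finset.mem_filter.1 hs)

theorem qp_face_convex {P F : Set (Fin d → ℝ)} (hP : Convex ℝ P) (h : IsFace P F) :
    Convex ℝ F := by
  rcases h with rfl | rfl | ⟨f, c, _, rfl⟩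
  · exact convex_empty
  · exact hP
  · exact hP.inter (convex_hyperplane f.isLinear c)

theorem qp_face_eq_hull (S : Finset (Fin d → ℝ)) {F : Set (Fin d → ℝ)}
    (h : IsFace (convexHull ℝ (S : Set (Fin d → ℝ))) F) :
    F = convexHull ℝ ((S.filter (fun s => s ∈ F) : Finset (Fin d → ℝ)) : Set (Fin d → ℝ)) := by
  have hc := qp_face_convex (convex_convexHull ℝ _) h
  apply Set.Subset.antisymm
  · rcases h with rfl | rfl | ⟨f, c, hf, rfl⟩
    · exact Set.empty_subset _
    · apply convexHull_mono
      intro s hs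
      simp only [Finset.coe_filter, Set.mem_ofPred_eq]
      exact ⟨hs, subset_convexHull ℝ _ hs⟩
    · refine (qp_filter_hull S f c (fun s hs => hf s (subset_convexHull ℝ _ hs))).trans ?_
      apply convexHull_mono
      rintro s ⟨hs, hs'⟩
      simp only [Finset.coe_filter, Set.mem_ofPred_eq]
      exact ⟨hs, subset_convexHull ℝ _ hs, hs'⟩
  · apply convexHull_min _ hc
    intro s hs
    simp only [Finset.coe_filter, Set.mem_ofPred_eq] at hs
    exact hs.2

theorem qp_face_polytope {P F : Set (Fin d → ℝ)} (hP : IsPolytope P) (h : IsFace P F) :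
    IsPolytope F := by
  obtain ⟨S, rfl⟩ := hP
  exact ⟨_, qp_face_eq_hull S h⟩

theorem qp_convex {P : Set (Fin d → ℝ)} (hP : IsPolytope P) : Convex ℝ P := by
  obtain ⟨S, rfl⟩ := hP
  exact convex_convexHull ℝ _

theorem qp_compact {P : Set (Fin d → ℝ)} (hP : IsPolytope P) : IsCompact P := by
  obtain ⟨S, rfl⟩ := hP
  exact S.finite_toSet.isCompact_convexHull ℝ

theorem qp_finite_faces {P : Set (Fin d → ℝ)} (hP : IsPolytope P) :
    {F : Set (Fin d → ℝ) | IsFace P F}.Finite := by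
  obtain ⟨S, rfl⟩ := hP
  refine (S.powerset.finite_toSet.image
    (fun T : Finset (Fin d → ℝ) => convexHull ℝ (T : Set (Fin d → ℝ)))).subset ?_
  intro F hF
  refine ⟨S.filter (fun s => s ∈ F), ?_, (qp_face_eq_hull S hF).symm⟩
  exact Finset.mem_coe.2 (Finset.mem_powerset.2 (Finset.filter_subset _ _))

theorem qp_ri_set_convex {A : Set (Fin d → ℝ)} (hA : Convex ℝ A) {x : Fin d → ℝ} (hx : x ∈ A) :
    Convex ℝ {y : Fin d → ℝ | ∃ t : ℝ, 0 < t ∧ x + t • (x - y) ∈ A} := by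
  have mono : ∀ (y : Fin d → ℝ) (t t' : ℝ), 0 < t' → t' ≤ t → x + t • (x - y) ∈ A →
      x + t' • (x - y) ∈ A := by
    intro y t t' h0 hle h
    have ht : 0 < t := lt_of_lt_of_le h0 hle
    have := hA hx h (a := 1 - t' / t) (b := t' / t)
      (by rw [sub_nonneg, div_le_one ht]; exact hle) (by positivity) (by ring)
    convert this using 1
    rw [smul_add, smul_smul, div_mul_cancel₀ _ ht.ne']
    module
  rintro y ⟨t, ht, hty⟩ z ⟨u, hu, huz⟩ a b ha hb hab
  refine ⟨min t u, lt_min ht hu, ?_⟩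
  have h1 := mono y t _ (lt_min ht hu) (min_le_left _ _) hty
  have h2 := mono z u _ (lt_min ht hu) (min_le_right _ _) huz
  have h3 := hA h1 h2 ha hb hab
  convert h3 using 1
  have : b = 1 - a := by linarith
  subst this
  module

theorem qp_exists_face_ri {P : Set (Fin d → ℝ)} (hP : IsPolytope P) {x : Fin d → ℝ}
    (hx : x ∈ P) : ∃ E, IsFace P E ∧ x ∈ QPri E := by
  obtain ⟨S, rfl⟩ := hP
  set P := convexHull ℝ (S : Set (Fin d → ℝ)) with hPdef
  have key : ∀ s : Fin d → ℝ, ∃ f : (Fin d → ℝ) →ₗ[ℝ] ℝ, (∀ i ∈ S, 0 ≤ f (i - x)) ∧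
      (f (x - s) < 0 ∨ ∃ w : (Fin d → ℝ) → ℝ, (∀ i ∈ S, 0 ≤ w i) ∧
        x - s = ∑ i ∈ S, w i • (i - x)) := by
    intro s
    rcases qp_farkas S (fun i => i - x) (x - s) with h | ⟨f, hf, hfb⟩
    · exact ⟨0, by simp, Or.inr h⟩
    · exact ⟨f, hf, Or.inl hfb⟩
  choose f hf0 hf1 using key
  set g : (Fin d → ℝ) →ₗ[ℝ] ℝ := -∑ s ∈ S, f s with hg
  have hgS : ∀ s ∈ S, g s ≤ g x := by
    intro s hs
    have : 0 ≤ (∑ r ∈ S, f r) (s - x) := by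
      rw [LinearMap.sum_apply]
      exact Finset.sum_nonneg fun r _ => hf0 r s hs
    rw [map_sub] at this
    simp only [hg, LinearMap.neg_apply]
    linarith
  have hgP : ∀ y ∈ P, g y ≤ g x := by
    intro y hy
    exact convexHull_min (t := {y | g y ≤ g x}) hgS (convex_halfSpace_le g.isLinear _) hy
  refine ⟨{y ∈ P | g y = g x}, Or.inr (Or.inr ⟨g, g x, hgP, rfl⟩), ⟨hx, rfl⟩, ?_⟩
  have hsub : {y ∈ P | g y = g x} ⊆ {y : Fin d → ℝ | ∃ t : ℝ, 0 < t ∧ x + t • (x - y) ∈ P} := by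
    refine (qp_filter_hull S g (g x) hgS).trans ?_
    refine convexHull_min ?_ (qp_ri_set_convex (convex_convexHull ℝ _) hx)
    rintro s ⟨hs, hgs⟩
    have hz : f s (s - x) = 0 := by
      have h0 : ∑ r ∈ S, f r (s - x) = 0 := by
        have h1 : g (s - x) = 0 := by rw [map_sub, hgs, sub_self]
        simp only [hg, LinearMap.neg_apply, LinearMap.sum_apply] at h1
        linarith
      rw [Finset.sum_eq_zero_iff_of_nonneg (fun r _ => hf0 r s hs)] at h0
      exact h0 s hs
    rcases hf1 s with h | ⟨w, hw0, hw⟩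
    · have : f s (x - s) = - f s (s - x) := by rw [← map_neg, neg_sub]
      rw [this, hz] at h
      simp at h
    · have hW : 0 ≤ ∑ i ∈ S, w i := Finset.sum_nonneg hw0
      set W := ∑ i ∈ S, w i with hWd
      refine ⟨1 / (1 + W), by positivity, ?_⟩
      rw [hw]
      have h1 : x + (1 / (1 + W)) • ∑ i ∈ S, w i • (i - x) =
          (1 / (1 + W)) • x + ∑ i ∈ S, (w i / (1 + W)) • i := by
        simp only [smul_sub, Finset.sum_sub_distrib, ← Finset.sum_smul, Finset.smul_sum, smul_smul]
        rw [← hWd]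
        have : ∀ i : Fin d → ℝ, w i / (1 + W) = 1 / (1 + W) * w i := fun i => by ring
        simp only [this]
        have h2 : x = (1 / (1 + W)) • x + (1 / (1 + W) * W) • x := by
          rw [← add_smul]
          have : 1 / (1 + W) + 1 / (1 + W) * W = 1 := by field_simp
          rw [this, one_smul]
        nth_rewrite 1 [h2]
        abel
      rw [h1]
      have := (convex_convexHull ℝ (S : Set (Fin d → ℝ))).sum_mem
        (t := Finset.insertNone S) (w := fun o : Option (Fin d → ℝ) => o.elim (1 / (1 + W)) (fun i => w i / (1 + W)))
        (z := fun o : Option (Fin d → ℝ) => o.elim x id) ?_ ?_ ?_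
      · simpa using this
      · intro o ho
        cases o with
        | none => simp only [Option.elim]; positivity
        | some i =>
          simp only [Option.elim]
          exact div_nonneg (hw0 i (by simpa using ho)) (by positivity)
      · simp only [Finset.sum_insertNone, Option.elim, ← Finset.sum_div, ← hWd]
        field_simp
      · intro o ho
        cases o with
        | none => exact hx
        | some i => exact subset_convexHull ℝ _ (by simpa using ho)
  intro y hy
  obtain ⟨t, ht, hty⟩ := hsub hy
  refine ⟨t, ht, hty, ?_⟩
  simp [hy.2]

theorem qp_ii_nhds {F : Set (Fin d → ℝ)} {p : Fin d → ℝ} (hp : p ∈ intrinsicInterior ℝ F) :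
    ∀ᶠ w in nhds (0 : Fin d → ℝ), w ∈ (affineSpan ℝ F).direction → p + w ∈ F := by
  rw [mem_intrinsicInterior] at hp
  obtain ⟨y, hy, rfl⟩ := hp
  rw [mem_interior_iff_mem_nhds, mem_nhds_subtype] at hy
  obtain ⟨u, hu, hsub⟩ := hy
  have ht : Filter.Tendsto (fun w : Fin d → ℝ => (y : Fin d → ℝ) + w) (nhds 0)
      (nhds (y : Fin d → ℝ)) := by
    have : Continuous (fun w : Fin d → ℝ => (y : Fin d → ℝ) + w) := by fun_prop
    simpa using this.tendsto 0
  filter_upwards [ht hu] with w hw hwd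
  have hmem : (y : Fin d → ℝ) + w ∈ affineSpan ℝ F := by
    have := AffineSubspace.vadd_mem_of_mem_direction hwd y.2
    rwa [vadd_eq_add, add_comm] at this
  exact hsub (show (⟨_, hmem⟩ : affineSpan ℝ F) ∈ Subtype.val ⁻¹' u from hw)

theorem qp_ii_subset_ri {F : Set (Fin d → ℝ)} : intrinsicInterior ℝ F ⊆ QPri F := by
  intro p hp
  have hpF := intrinsicInterior_subset hp
  refine ⟨hpF, fun y hy => ?_⟩
  have h := qp_ii_nhds hp
  have ht : Filter.Tendsto (fun t : ℝ => t • (p - y)) (nhdsWithin 0 (Set.Ioi 0)) (nhds 0) := by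
    have : Continuous (fun t : ℝ => t • (p - y)) := by fun_prop
    have h2 := this.tendsto 0
    rw [zero_smul] at h2
    exact h2.mono_left nhdsWithin_le_nhds
  obtain ⟨t, h1, h2⟩ := ((ht.eventually h).and self_mem_nhdsWithin).exists
  refine ⟨t, h2, h1 ?_⟩
  refine Submodule.smul_mem _ _ ?_
  exact AffineSubspace.vsub_mem_direction (subset_affineSpan ℝ F hpF) (subset_affineSpan ℝ F hy)

theorem qp_ri_combine {E : Set (Fin d → ℝ)} (hE : Convex ℝ E) {q y : Fin d → ℝ} (hq : q ∈ E)
    (hy : y ∈ QPri E) {t : ℝ} (ht0 : 0 < t) (ht1 : t < 1) : (1 - t) • q + t • y ∈ QPri E := by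
  refine ⟨hE hq hy.1 (by linarith) ht0.le (by ring), fun z hz => ?_⟩
  obtain ⟨s, hs, hm⟩ := hy.2 z hz
  have hden : 0 < 1 + s - t * s := by nlinarith
  refine ⟨t * s / (1 + s - t * s), by positivity, ?_⟩
  have := hE hq hm (a := (1 - t) * (1 + s) / (1 + s - t * s)) (b := t / (1 + s - t * s))
    (div_nonneg (mul_nonneg (by linarith) (by linarith)) hden.le) (by positivity)
    (by field_simp; ring)
  convert this using 1
  match_scalars <;> field_simp <;> ring

theorem qp_slice_polytope {P : Set (Fin d → ℝ)} (hP : IsPolytope P)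
    (M : AffineSubspace ℝ (Fin d → ℝ)) : IsPolytope (P ∩ M) := by
  have hcl : IsClosed (M : Set (Fin d → ℝ)) := AffineSubspace.closed_of_finiteDimensional M
  have hcomp : IsCompact (P ∩ M) := (qp_compact hP).inter_right hcl
  have hconv : Convex ℝ (P ∩ M) := (qp_convex hP).inter M.convex
  have hex : ∀ x : Fin d → ℝ, ∃ E, x ∈ P → IsFace P E ∧ x ∈ QPri E := by
    intro x
    by_cases hx : x ∈ P
    · obtain ⟨E, h⟩ := qp_exists_face_ri hP hx
      exact ⟨E, fun _ => h⟩
    · exact ⟨∅, fun h => (hx h).elim⟩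
  choose e he using hex
  have hfin : ((P ∩ M).extremePoints ℝ).Finite := by
    refine Set.Finite.of_finite_image (f := e) ((qp_finite_faces hP).subset ?_) ?_
    · rintro _ ⟨x, hx, rfl⟩
      exact (he x hx.1.1).1
    · intro x hx y hy hxy
      by_contra hne
      have hxr := (he x hx.1.1).2
      have hyE : y ∈ e x := hxy ▸ (he y hy.1.1).2.1
      obtain ⟨t, ht, hty⟩ := hxr.2 y hyE
      have hzP := qp_face_subset (he x hx.1.1).1 hty
      have hzM : x + t • (x - y) ∈ M := by
        have := AffineSubspace.vadd_mem_of_mem_direction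
          (Submodule.smul_mem _ t (AffineSubspace.vsub_mem_direction hx.1.2 hy.1.2)) hx.1.2
        rwa [vadd_eq_add, add_comm] at this
      have := hx.2 hy.1 ⟨hzP, hzM⟩ ?_
      · exact hne this.symm
      · refine ⟨t / (1 + t), 1 / (1 + t), by positivity, by positivity, by field_simp; ring, ?_⟩
        match_scalars <;> field_simp <;> ring
  refine ⟨hfin.toFinset, ?_⟩
  rw [Set.Finite.coe_toFinset]
  have := closure_convexHull_extremePoints hcomp hconv
  rw [(hfin.isClosed_convexHull ℝ).closure_eq] at this
  exact this.symm

open Pointwise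

theorem qp_mem_translate {L : AffineSubspace ℝ (Fin d → ℝ)} {p v x : Fin d → ℝ} (hp : p ∈ L) :
    x ∈ (v +ᵥ (L : Set (Fin d → ℝ)) : Set (Fin d → ℝ)) ↔ x - p - v ∈ L.direction := by
  rw [Set.mem_vadd_set_iff_neg_vadd_mem, vadd_eq_add, SetLike.mem_coe,
    ← AffineSubspace.vsub_right_mem_direction_iff_mem hp, vsub_eq_sub]
  have : -v + x - p = x - p - v := by abel
  rw [this]

/-- Points near `p` in the direction of `F` composed with a linear map. -/
theorem qp_dir_point {F : Set (Fin d → ℝ)} {p w : Fin d → ℝ} (hp : p ∈ intrinsicInterior ℝ F)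
    (hw : w ∈ (affineSpan ℝ F).direction) : ∃ t : ℝ, 0 < t ∧ t < 1 ∧ p + (t / (1 - t)) • w ∈ F := by
  have h := qp_ii_nhds hp
  have ht : Filter.Tendsto (fun t : ℝ => (t / (1 - t)) • w) (nhdsWithin 0 (Set.Ioi 0)) (nhds 0) := by
    have : ContinuousAt (fun t : ℝ => (t / (1 - t)) • w) 0 := by
      have hd : ContinuousAt (fun t : ℝ => t / (1 - t)) 0 :=
        ContinuousAt.div continuousAt_id (continuousAt_const.sub continuousAt_id) (by norm_num)
      exact hd.smul continuousAt_const
    have h2 := this.tendsto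
    simp only [zero_div, zero_smul] at h2
    exact h2.mono_left nhdsWithin_le_nhds
  have h1 : ∀ᶠ t : ℝ in nhdsWithin 0 (Set.Ioi 0), t < 1 :=
    nhdsWithin_le_nhds (Iio_mem_nhds one_pos)
  have h0 : ∀ᶠ t : ℝ in nhdsWithin 0 (Set.Ioi 0), 0 < t := self_mem_nhdsWithin
  obtain ⟨t, h1, h2, h3⟩ := ((ht.eventually h).and (h0.and h1)).exists
  exact ⟨t, h2, h3, h1 (Submodule.smul_mem _ _ hw)⟩

theorem qp_key {P F : Set (Fin d → ℝ)} (hPc : Convex ℝ P) (hF : IsFace P F)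
    {L : AffineSubspace ℝ (Fin d → ℝ)} {p : Fin d → ℝ}
    (hLP : (L : Set (Fin d → ℝ)) ∩ P = {p}) (hrel : p ∈ intrinsicInterior ℝ F)
    {x u w : Fin d → ℝ} (hx : x ∈ P) (hu : u ∈ L.direction)
    (hw : w ∈ (affineSpan ℝ F).direction) (hxe : x - p = u + w) : u = 0 ∧ x ∈ F := by
  have hpL : p ∈ L := by
    have : p ∈ (L : Set (Fin d → ℝ)) ∩ P := by rw [hLP]; rfl
    exact this.1
  have hpF : p ∈ F := intrinsicInterior_subset hrel
  obtain ⟨t, ht0, ht1, htF⟩ := qp_dir_point hrel (Submodule.neg_mem _ hw)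
  have hmem := hPc (qp_face_subset hF htF) hx (a := 1 - t) (b := t) (by linarith) ht0.le (by ring)
  have h1t : (1 - t) ≠ 0 := by linarith
  have hxe' : x = p + (u + w) := by rw [← hxe]; abel
  have heq : (1 - t) • (p + (t / (1 - t)) • -w) + t • x = p + t • u := by
    rw [hxe', smul_add (1 - t), smul_smul, mul_div_cancel₀ _ h1t]
    module
  rw [heq] at hmem
  have hmL : p + t • u ∈ (L : Set (Fin d → ℝ)) := by
    have := AffineSubspace.vadd_mem_of_mem_direction (Submodule.smul_mem _ t hu) hpL
    rwa [vadd_eq_add, add_comm] at this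
  have h2 : p + t • u ∈ ({p} : Set (Fin d → ℝ)) := by rw [← hLP]; exact ⟨hmL, hmem⟩
  have h3 : t • u = 0 := by simpa using h2
  have hu0 : u = 0 := (smul_eq_zero.1 h3).resolve_left ht0.ne'
  refine ⟨hu0, ?_⟩
  rw [hu0, zero_add] at hxe'
  rcases hF with rfl | rfl | ⟨f, c, hf, rfl⟩
  · exact hpF.elim
  · exact hx
  · refine ⟨hx, ?_⟩
    have hsub : (affineSpan ℝ {x ∈ P | f x = c}).direction ≤ LinearMap.ker f := by
      rw [direction_affineSpan, vectorSpan_def, Submodule.span_le]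
      rintro _ ⟨a, ha, b, hb, rfl⟩
      simp [ha.2, hb.2]
    have := hsub hw
    rw [LinearMap.mem_ker] at this
    rw [hxe', map_add, this, hpF.2, add_zero]

theorem qp_functional {P F : Set (Fin d → ℝ)} (hPc : Convex ℝ P) (hF : IsFace P F)
    {k : ℤ} (hk : pdim F = k)
    {L : AffineSubspace ℝ (Fin d → ℝ)}
    (hL : (Module.finrank ℝ L.direction : ℤ) = (d : ℤ) - k - 1) {p : Fin d → ℝ}
    (hLP : (L : Set (Fin d → ℝ)) ∩ P = {p}) (hrel : p ∈ intrinsicInterior ℝ F) :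
    Disjoint L.direction (affineSpan ℝ F).direction ∧
    ∃ φ : (Fin d → ℝ) →ₗ[ℝ] ℝ, LinearMap.ker φ = L.direction ⊔ (affineSpan ℝ F).direction := by
  have hpF : p ∈ F := intrinsicInterior_subset hrel
  have hpP := qp_face_subset hF hpF
  have hdis : Disjoint L.direction (affineSpan ℝ F).direction := by
    rw [Submodule.disjoint_def]
    intro u hu hw
    exact (qp_key hPc hF hLP hrel hpP hu (Submodule.neg_mem _ hw) (by simp)).1
  refine ⟨hdis, ?_⟩
  have hne : F ≠ ∅ := Set.Nonempty.ne_empty ⟨p, hpF⟩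
  rw [pdim, if_neg hne] at hk
  have hfr := Submodule.finrank_sup_add_finrank_inf_eq L.direction (affineSpan ℝ F).direction
  rw [hdis.eq_bot, finrank_bot] at hfr
  set V := L.direction ⊔ (affineSpan ℝ F).direction with hV
  have hq := Submodule.finrank_quotient_add_finrank V
  rw [Module.finrank_fin_fun] at hq
  have hq1 : Module.finrank ℝ ((Fin d → ℝ) ⧸ V) = 1 := by omega
  let e : ((Fin d → ℝ) ⧸ V) ≃ₗ[ℝ] ℝ := LinearEquiv.ofFinrankEq _ _ (by simp [hq1])
  refine ⟨e.toLinearMap.comp V.mkQ, ?_⟩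
  rw [LinearEquiv.ker_comp, Submodule.ker_mkQ]

theorem qp_ne {P F : Set (Fin d → ℝ)} (hPc : Convex ℝ P) (hF : IsFace P F)
    {L : AffineSubspace ℝ (Fin d → ℝ)} {p : Fin d → ℝ}
    (hLP : (L : Set (Fin d → ℝ)) ∩ P = {p}) (hrel : p ∈ intrinsicInterior ℝ F)
    {φ : (Fin d → ℝ) →ₗ[ℝ] ℝ} (hφ : LinearMap.ker φ = L.direction ⊔ (affineSpan ℝ F).direction)
    {x : Fin d → ℝ} (hx : x ∈ P) (hxF : x ∉ F) : φ (x - p) ≠ 0 := by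
  intro h
  have : x - p ∈ LinearMap.ker φ := h
  rw [hφ, Submodule.mem_sup] at this
  obtain ⟨u, hu, w, hw, huw⟩ := this
  exact hxF (qp_key hPc hF hLP hrel hx hu hw huw.symm).2

theorem qp_same_sign {P F : Set (Fin d → ℝ)} (hPc : Convex ℝ P) (hF : IsFace P F)
    {L : AffineSubspace ℝ (Fin d → ℝ)} {p : Fin d → ℝ}
    (hLP : (L : Set (Fin d → ℝ)) ∩ P = {p}) (hrel : p ∈ intrinsicInterior ℝ F)
    {φ : (Fin d → ℝ) →ₗ[ℝ] ℝ} (hφ : LinearMap.ker φ = L.direction ⊔ (affineSpan ℝ F).direction)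
    {x y : Fin d → ℝ} (hx : x ∈ P) (hxF : x ∉ F) (hy : y ∈ P) (hyF : y ∉ F) :
    0 < φ (x - p) / φ (y - p) := by
  have hx0 := qp_ne hPc hF hLP hrel hφ hx hxF
  have hy0 := qp_ne hPc hF hLP hrel hφ hy hyF
  by_contra hcon
  push Not at hcon
  set r := φ (x - p) / φ (y - p) with hr
  have hrx : φ (x - p) = r * φ (y - p) := by rw [hr, div_mul_cancel₀ _ hy0]
  have h1r : 0 < 1 - r := by linarith
  have hz := hPc hx hy (a := 1 / (1 - r)) (b := -r / (1 - r)) (by positivity)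
    (div_nonneg (by linarith) h1r.le) (by field_simp; ring)
  have hr0 : r ≠ 0 := fun h => hx0 (by rw [hrx, h, zero_mul])
  refine qp_ne hPc hF hLP hrel hφ hz ?_ ?_
  · rcases hF with rfl | rfl | ⟨f, c, hf, rfl⟩
    · exact fun h => h
    · exact (hxF hx).elim
    · intro hzF
      have hfx : f x < c := lt_of_le_of_ne (hf x hx) fun h => hxF ⟨hx, h⟩
      have hfy : f y ≤ c := hf y hy
      have h := hzF.2
      simp only [map_add, map_smul, smul_eq_mul] at h
      have h' : f x + -r * f y = c * (1 - r) := by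
        field_simp at h
        linarith
      nlinarith
  · have : (1 / (1 - r)) • x + (-r / (1 - r)) • y - p =
        (1 / (1 - r)) • (x - p) + (-r / (1 - r)) • (y - p) := by
      match_scalars <;> field_simp <;> ring
    rw [this, map_add, map_smul, map_smul, hrx]
    simp only [smul_eq_mul]
    field_simp; ring

/-- Small translates only meet faces containing `p`. -/
theorem qp_small_face {P E : Set (Fin d → ℝ)} (hP : IsPolytope P) (hE : IsFace P E)
    {L : AffineSubspace ℝ (Fin d → ℝ)} {p : Fin d → ℝ}
    (hLP : (L : Set (Fin d → ℝ)) ∩ P = {p}) :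
    ∀ᶠ v in nhds (0 : Fin d → ℝ), ∀ x ∈ E, x - p - v ∈ L.direction → p ∈ E := by
  have hpL : p ∈ L := by
    have : p ∈ (L : Set (Fin d → ℝ)) ∩ P := by rw [hLP]; rfl
    exact this.1
  by_cases hpE : p ∈ E
  · exact Filter.Eventually.of_forall fun _ _ _ _ => hpE
  have hEc : IsCompact E := qp_compact (qp_face_polytope hP hE)
  have hUc : IsClosed (L.direction : Set (Fin d → ℝ)) := Submodule.closed_of_finiteDimensional _
  have hcl := hUc.add_left_of_isCompact (hEc.image (f := fun x => x - p) (by fun_prop))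
  have h0 : (0 : Fin d → ℝ) ∉ ((fun x => x - p) '' E) + (L.direction : Set (Fin d → ℝ)) := by
    rintro ⟨_, ⟨x, hx, rfl⟩, u, hu, hxu⟩
    have hxu' : x - p + u = 0 := hxu
    have hx' : x = -u + p := by
      rw [← sub_eq_zero, ← hxu']; abel
    have hxL : x ∈ (L : Set (Fin d → ℝ)) := by
      rw [hx']
      exact AffineSubspace.vadd_mem_of_mem_direction (Submodule.neg_mem _ hu) hpL
    have : x ∈ ({p} : Set (Fin d → ℝ)) := by rw [← hLP]; exact ⟨hxL, qp_face_subset hE hx⟩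
    exact hpE (this ▸ hx)
  filter_upwards [hcl.isOpen_compl.mem_nhds h0] with v hv x hx hxv
  exact (hv ⟨x - p, ⟨x, hx, rfl⟩, -(x - p - v), Submodule.neg_mem _ hxv, by
    show x - p + -(x - p - v) = v
    abel⟩).elim

/-- Small translates on the correct side meet the relative interior of faces above `F`. -/
theorem qp_small_meet {P F E : Set (Fin d → ℝ)} (hP : IsPolytope P) (hF : IsFace P F)
    {L : AffineSubspace ℝ (Fin d → ℝ)} {p : Fin d → ℝ}
    (hLP : (L : Set (Fin d → ℝ)) ∩ P = {p}) (hrel : p ∈ intrinsicInterior ℝ F)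
    (hdis : Disjoint L.direction (affineSpan ℝ F).direction)
    {φ : (Fin d → ℝ) →ₗ[ℝ] ℝ} (hφ : LinearMap.ker φ = L.direction ⊔ (affineSpan ℝ F).direction)
    (hE : IsFace P E) (hFE : F ⊆ E) (hne : E ≠ F) :
    ∀ᶠ v in nhds (0 : Fin d → ℝ), ∀ z ∈ P, z ∉ F → φ v = φ (z - p) →
      ∃ x ∈ QPri E, x - p - v ∈ L.direction := by
  have hPc := qp_convex hP
  have hEP := qp_face_polytope hP hE
  have hEc := qp_convex hEP
  have hpF : p ∈ F := intrinsicInterior_subset hrel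
  have hEne : E.Nonempty := ⟨p, hFE hpF⟩
  obtain ⟨y, hy⟩ := hEne.intrinsicInterior hEc
  have hyr := qp_ii_subset_ri hy
  have hyP : y ∈ P := qp_face_subset hE hyr.1
  have hyF : y ∉ F := fun h => hne
    (Set.Subset.antisymm (qp_face_of_ri hF (qp_face_subset hE) hyr h) hFE)
  have hy0 := qp_ne hPc hF hLP hrel hφ hyP hyF
  set U := L.direction with hU
  set W := (affineSpan ℝ F).direction with hW
  have hinj : LinearMap.ker (LinearMap.coprod U.subtype W.subtype) = ⊥ := by
    rw [LinearMap.ker_coprod_of_disjoint_range]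
    · simp
    · simpa using hdis
  obtain ⟨g, hg⟩ := LinearMap.exists_leftInverse_of_injective _ hinj
  set pr : (Fin d → ℝ) →ₗ[ℝ] (Fin d → ℝ) := W.subtype ∘ₗ LinearMap.snd ℝ U W ∘ₗ g with hpr
  have hprW : ∀ x, pr x ∈ W := fun x => by simp [hpr]
  have hprU : ∀ x, φ x = 0 → x - pr x ∈ U := by
    intro x hx
    have : x ∈ LinearMap.ker φ := hx
    rw [hφ, Submodule.mem_sup] at this
    obtain ⟨u, hu, w, hw, rfl⟩ := this
    have h1 := LinearMap.congr_fun hg (⟨u, hu⟩, ⟨w, hw⟩)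
    simp only [LinearMap.comp_apply, LinearMap.coprod_apply, Submodule.subtype_apply,
      LinearMap.id_apply] at h1
    have h2 : pr (u + w) = w := by
      simp only [hpr, LinearMap.comp_apply]
      rw [h1]; rfl
    rw [h2]
    simpa using hu
  have hφc : Continuous φ := φ.continuous_of_finiteDimensional
  have hprc : Continuous pr := pr.continuous_of_finiteDimensional
  let T : (Fin d → ℝ) → ℝ := fun v => φ v / φ (y - p)
  have hT : Continuous T := hφc.div_const _
  have hT0 : T 0 = 0 := by simp [T]
  have hTlt : ∀ᶠ v in nhds (0 : Fin d → ℝ), T v < 1 := by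
    have := hT.tendsto 0
    rw [hT0] at this
    exact this (Iio_mem_nhds one_pos)
  have hlim : Filter.Tendsto (fun v => (1 / (1 - T v)) • pr (v - T v • (y - p)))
      (nhds (0 : Fin d → ℝ)) (nhds 0) := by
    have hc : ContinuousAt (fun v => (1 / (1 - T v)) • pr (v - T v • (y - p)))
        (0 : Fin d → ℝ) := by
      have hd : ContinuousAt (fun v => 1 / (1 - T v)) (0 : Fin d → ℝ) :=
        ContinuousAt.div continuousAt_const (continuousAt_const.sub hT.continuousAt) (by simp [hT0])
      refine hd.smul ?_
      exact (hprc.comp (continuous_id.sub (hT.smul continuous_const))).continuousAt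
    have := hc.tendsto
    simpa [hT0] using this
  filter_upwards [hTlt, hlim.eventually (qp_ii_nhds hrel)] with v hv1 hv2 z hzP hzF hvz
  have hTpos : 0 < T v := by
    simp only [T, hvz]
    exact qp_same_sign hPc hF hLP hrel hφ hzP hzF hyP hyF
  have hq := hFE (hv2 (Submodule.smul_mem _ _ (hprW _)))
  refine ⟨_, qp_ri_combine hEc hq hyr hTpos hv1, ?_⟩
  have h1t : 1 - T v ≠ 0 := by linarith
  have hφ0 : φ (v - T v • (y - p)) = 0 := by
    rw [map_sub, map_smul, smul_eq_mul]
    simp only [T]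
    rw [div_mul_cancel₀ _ hy0, sub_self]
  have h3 := Submodule.neg_mem _ (hprU _ hφ0)
  convert h3 using 1
  rw [smul_add, smul_smul, mul_one_div_cancel h1t]
  module

theorem qp_interior_not_mem {P F : Set (Fin d → ℝ)} (hF : IsFace P F) (hne : F ≠ P)
    {z : Fin d → ℝ} (hz : z ∈ interior P) : z ∉ F := by
  intro hzF
  have hzr : z ∈ QPri P := qp_ii_subset_ri (interior_subset_intrinsicInterior hz)
  exact hne (Set.Subset.antisymm (qp_face_subset hF) (qp_face_of_ri hF le_rfl hzr hzF))

theorem qp_slice_dim {P : Set (Fin d → ℝ)} (M : AffineSubspace ℝ (Fin d → ℝ))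
    {z : Fin d → ℝ} (hz : z ∈ interior P) (hzM : z ∈ M) :
    pdim (P ∩ M) = Module.finrank ℝ M.direction := by
  have hzQ : z ∈ P ∩ (M : Set (Fin d → ℝ)) := ⟨interior_subset hz, hzM⟩
  have hne : P ∩ (M : Set (Fin d → ℝ)) ≠ ∅ := Set.Nonempty.ne_empty ⟨z, hzQ⟩
  rw [pdim, if_neg hne]
  have : (affineSpan ℝ (P ∩ (M : Set (Fin d → ℝ)))).direction = M.direction := by
    apply le_antisymm
    · exact AffineSubspace.direction_le (affineSpan_le.2 Set.inter_subset_right)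
    · intro u hu
      have ht : Filter.Tendsto (fun t : ℝ => t • u + z) (nhdsWithin 0 (Set.Ioi 0)) (nhds z) := by
        have hc : Continuous (fun t : ℝ => t • u + z) := by fun_prop
        have h2 := hc.tendsto 0
        rw [zero_smul, zero_add] at h2
        exact h2.mono_left nhdsWithin_le_nhds
      have h0 : ∀ᶠ t : ℝ in nhdsWithin 0 (Set.Ioi 0), 0 < t := self_mem_nhdsWithin
      have h1 : ∀ᶠ t : ℝ in nhdsWithin 0 (Set.Ioi 0), t • u + z ∈ P :=
        ht (mem_interior_iff_mem_nhds.1 hz)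
      obtain ⟨t, ht0, htP⟩ := (h0.and h1).exists
      have htM : t • u + z ∈ (M : Set (Fin d → ℝ)) :=
        AffineSubspace.vadd_mem_of_mem_direction (Submodule.smul_mem _ t hu) hzM
      have htQ : t • u + z ∈ P ∩ (M : Set (Fin d → ℝ)) := ⟨htP, htM⟩
      have h3 := AffineSubspace.vsub_mem_direction
        (subset_affineSpan ℝ (P ∩ (M : Set (Fin d → ℝ))) htQ)
        (subset_affineSpan ℝ (P ∩ (M : Set (Fin d → ℝ))) hzQ)
      have h4 := Submodule.smul_mem _ t⁻¹ h3
      rwa [vsub_eq_sub, add_sub_cancel_right, smul_smul, inv_mul_cancel₀ ht0.ne', one_smul] at h4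
  rw [this]

/-- The carrier of a nonempty face of a slice. -/
theorem qp_slice_face {P : Set (Fin d → ℝ)} (hP : IsPolytope P)
    (M : AffineSubspace ℝ (Fin d → ℝ)) {G : Set (Fin d → ℝ)} (hG : IsFace (P ∩ M) G)
    (hne : G ≠ ∅) :
    IsFace P (⋂₀ {E : Set (Fin d → ℝ) | IsFace P E ∧ G ⊆ E}) ∧
      G = (⋂₀ {E : Set (Fin d → ℝ) | IsFace P E ∧ G ⊆ E}) ∩ M := by
  have hQ := qp_slice_polytope hP M
  have hGc := qp_convex (qp_face_polytope hQ hG)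
  have hGQ := qp_face_subset hG
  obtain ⟨x, hx⟩ := (Set.nonempty_iff_ne_empty.2 hne).intrinsicInterior hGc
  have hxr := qp_ii_subset_ri hx
  obtain ⟨E, hE, hxE⟩ := qp_exists_face_ri hP (hGQ hxr.1).1
  have hGE : G ⊆ E := qp_face_of_ri hE (hGQ.trans Set.inter_subset_left) hxr hxE.1
  have hEq : ⋂₀ {E : Set (Fin d → ℝ) | IsFace P E ∧ G ⊆ E} = E := by
    apply Set.Subset.antisymm
    · exact Set.sInter_subset_of_mem ⟨hE, hGE⟩
    · apply Set.subset_sInter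
      rintro E' ⟨hE', hGE'⟩
      exact qp_face_of_ri hE' (qp_face_subset hE) hxE (hGE' hxr.1)
  rw [hEq]
  refine ⟨hE, Set.Subset.antisymm (fun y hy => ⟨hGE hy, (hGQ hy).2⟩) ?_⟩
  have hxM : x ∈ M := (hGQ hxr.1).2
  refine qp_face_of_ri hG (Set.inter_subset_inter_left _ (qp_face_subset hE)) ?_ hxr.1
  refine ⟨⟨hxE.1, hxM⟩, fun y hy => ?_⟩
  obtain ⟨t, ht, hty⟩ := hxE.2 y hy.1
  refine ⟨t, ht, hty, ?_⟩
  have := AffineSubspace.vadd_mem_of_mem_direction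
    (Submodule.smul_mem _ t (AffineSubspace.vsub_mem_direction hxM hy.2)) hxM
  rwa [vadd_eq_add, add_comm] at this

theorem qp_face_slice {P E : Set (Fin d → ℝ)} (hE : IsFace P E)
    (M : Set (Fin d → ℝ)) : IsFace (P ∩ M) (E ∩ M) := by
  rcases hE with rfl | rfl | ⟨f, c, hf, rfl⟩
  · left; simp
  · right; left; rfl
  · right; right
    refine ⟨f, c, fun x hx => hf x hx.1, ?_⟩
    ext x
    constructor
    · rintro ⟨⟨h1, h2⟩, h3⟩; exact ⟨⟨h1, h3⟩, h2⟩
    · rintro ⟨⟨h1, h3⟩, h2⟩; exact ⟨⟨h1, h2⟩, h3⟩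

end Helpers

open Pointwise in
/-- If `P ⊆ ℝ^d` is a `d`-dimensional polytope, `F` a face with
`dim F = k`, and `L` an affine subspace of dimension `d−k−1` meeting `P` in exactly
one point, lying in the relative interior of `F`, then for every sufficiently small
translate `L′ = v +ᵥ L` of `L` meeting the interior of `P`, the slice `P ∩ L′` is a
`(d−k−1)`-dimensional polytope whose face poset is order-isomorphic to the interval
`[F,P]` via the map sending a nonempty face `G` to the smallest face of `P`
containing `G`, and `∅` to `F`. -/
theorem quotient_polytope_exists {d : ℕ} (P F : Set (Fin d → ℝ))
    (hP : IsPolytope P) (hfull : affineSpan ℝ P = ⊤) (hF : IsFace P F)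
    (k : ℤ) (hk : pdim F = k)
    (L : AffineSubspace ℝ (Fin d → ℝ))
    (hL : (Module.finrank ℝ L.direction : ℤ) = (d : ℤ) - k - 1)
    (p : Fin d → ℝ) (hLP : (L : Set (Fin d → ℝ)) ∩ P = {p})
    (hrel : p ∈ intrinsicInterior ℝ F) :
    ∃ ε > (0 : ℝ), ∀ v : Fin d → ℝ, ‖v‖ < ε →
      ((v +ᵥ (L : Set (Fin d → ℝ))) ∩ interior P).Nonempty →
      IsPolytope (P ∩ (v +ᵥ (L : Set (Fin d → ℝ)))) ∧
      pdim (P ∩ (v +ᵥ (L : Set (Fin d → ℝ)))) = (d : ℤ) - k - 1 ∧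
      Set.BijOn
        (fun G : Set (Fin d → ℝ) =>
          if G = ∅ then F else ⋂₀ {E : Set (Fin d → ℝ) | IsFace P E ∧ G ⊆ E})
        {G : Set (Fin d → ℝ) | IsFace (P ∩ (v +ᵥ (L : Set (Fin d → ℝ)))) G}
        {E : Set (Fin d → ℝ) | IsFace P E ∧ F ⊆ E} ∧
      ∀ G₁ ∈ {G : Set (Fin d → ℝ) | IsFace (P ∩ (v +ᵥ (L : Set (Fin d → ℝ)))) G},
        ∀ G₂ ∈ {G : Set (Fin d → ℝ) | IsFace (P ∩ (v +ᵥ (L : Set (Fin d → ℝ)))) G},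
          (G₁ ⊆ G₂ ↔
            (if G₁ = ∅ then F else ⋂₀ {E : Set (Fin d → ℝ) | IsFace P E ∧ G₁ ⊆ E}) ⊆
            (if G₂ = ∅ then F else ⋂₀ {E : Set (Fin d → ℝ) | IsFace P E ∧ G₂ ⊆ E})) := by
  have hPc := qp_convex hP
  have hpL : p ∈ L := by
    have : p ∈ (L : Set (Fin d → ℝ)) ∩ P := by rw [hLP]; rfl
    exact this.1
  have hpF : p ∈ F := intrinsicInterior_subset hrel
  obtain ⟨hdis, φ, hφ⟩ := qp_functional hPc hF hk hL hLP hrel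
  have hFP : F ≠ P := by
    rintro rfl
    rw [pdim, if_neg (Set.Nonempty.ne_empty ⟨p, hpF⟩), hfull, AffineSubspace.direction_top,
      finrank_top, Module.finrank_fin_fun] at hk
    omega
  have hev1 : ∀ᶠ v in nhds (0 : Fin d → ℝ), ∀ E ∈ {E : Set (Fin d → ℝ) | IsFace P E},
      ∀ x ∈ E, x - p - v ∈ L.direction → p ∈ E :=
    (Filter.eventually_all_finite (qp_finite_faces hP)).2 fun E hE => qp_small_face hP hE hLP
  have hev2 : ∀ᶠ v in nhds (0 : Fin d → ℝ), ∀ E ∈ {E : Set (Fin d → ℝ) | IsFace P E},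
      F ⊆ E → E ≠ F → ∀ z ∈ P, z ∉ F → φ v = φ (z - p) →
        ∃ x ∈ QPri E, x - p - v ∈ L.direction := by
    refine (Filter.eventually_all_finite (qp_finite_faces hP)).2 fun E hE => ?_
    by_cases h : F ⊆ E ∧ E ≠ F
    · filter_upwards [qp_small_meet hP hF hLP hrel hdis hφ hE h.1 h.2] with v hv _ _
      exact hv
    · exact Filter.Eventually.of_forall fun v h1 h2 => (h ⟨h1, h2⟩).elim
  obtain ⟨ε, hε, hball⟩ := Metric.eventually_nhds_iff.1 (hev1.and hev2)
  refine ⟨ε, hε, fun v hv hmeet => ?_⟩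
  obtain ⟨hv1, hv2⟩ := hball (by rwa [dist_zero_right] : dist v 0 < ε)
  obtain ⟨z, hzL, hzint⟩ := hmeet
  have hzP : z ∈ P := interior_subset hzint
  have hzF : z ∉ F := qp_interior_not_mem hF hFP hzint
  have hφU : ∀ u ∈ L.direction, φ u = 0 := fun u hu => by
    have : u ∈ LinearMap.ker φ := by rw [hφ]; exact Submodule.mem_sup_left hu
    exact this
  have hφz : φ v = φ (z - p) := by
    have := hφU _ ((qp_mem_translate hpL).1 hzL)
    rw [map_sub] at this
    linarith
  have hφp := qp_ne hPc hF hLP hrel hφ hzP hzF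
  have hMcoe : (v +ᵥ (L : Set (Fin d → ℝ)) : Set (Fin d → ℝ)) =
      ((v +ᵥ L : AffineSubspace ℝ (Fin d → ℝ)) : Set (Fin d → ℝ)) :=
    (AffineSubspace.coe_pointwise_vadd v L).symm
  set M : AffineSubspace ℝ (Fin d → ℝ) := v +ᵥ L with hM
  have hmemM : ∀ x : Fin d → ℝ, x ∈ M ↔ x - p - v ∈ L.direction := by
    intro x
    rw [← qp_mem_translate hpL, hMcoe]; rfl
  rw [hMcoe] at hzL ⊢
  have hFM : F ∩ M = ∅ := by
    apply Set.eq_empty_of_forall_notMem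
    rintro x ⟨hxF, hxM⟩
    have h1 := hφU _ ((hmemM x).1 hxM)
    have h2 : φ (x - p) = 0 := by
      have : x - p ∈ LinearMap.ker φ := by
        rw [hφ]
        exact Submodule.mem_sup_right (AffineSubspace.vsub_mem_direction
          (subset_affineSpan ℝ F hxF) (subset_affineSpan ℝ F hpF))
      exact this
    rw [map_sub, h2] at h1
    exact hφp (by rw [← hφz]; linarith)
  set Ψ : Set (Fin d → ℝ) → Set (Fin d → ℝ) := fun G =>
    if G = ∅ then F else ⋂₀ {E : Set (Fin d → ℝ) | IsFace P E ∧ G ⊆ E} with hΨ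
  have hrec : ∀ G, IsFace (P ∩ M) G → G = Ψ G ∩ M := by
    intro G hG
    by_cases h : G = ∅
    · simp only [hΨ, if_pos h]; rw [hFM, h]
    · simp only [hΨ, if_neg h]; exact (qp_slice_face hP M hG h).2
  have hmaps : ∀ G, IsFace (P ∩ M) G → IsFace P (Ψ G) ∧ F ⊆ Ψ G := by
    intro G hG
    by_cases h : G = ∅
    · simp only [hΨ, if_pos h]; exact ⟨hF, le_rfl⟩
    · have hface : IsFace P (Ψ G) := by
        simp only [hΨ, if_neg h]; exact (qp_slice_face hP M hG h).1
      refine ⟨hface, ?_⟩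
      obtain ⟨x, hx⟩ := Set.nonempty_iff_ne_empty.2 h
      rw [hrec G hG] at hx
      have hpE := hv1 _ hface x hx.1 ((hmemM x).1 hx.2)
      exact qp_face_of_ri hface (qp_face_subset hF) (qp_ii_subset_ri hrel) hpE
  refine ⟨qp_slice_polytope hP M, ?_, ⟨fun G hG => hmaps G hG, ?_, ?_⟩, ?_⟩
  · rw [qp_slice_dim M hzint hzL, hM, AffineSubspace.pointwise_vadd_direction, hL]
  · intro G₁ h₁ G₂ h₂ h
    rw [hrec G₁ h₁, hrec G₂ h₂]
    exact congrArg (· ∩ (M : Set (Fin d → ℝ))) h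
  · rintro E ⟨hE, hFE⟩
    by_cases hEF : E = F
    · exact ⟨∅, Or.inl rfl, by simp [hΨ, hEF]⟩
    · obtain ⟨x, hxr, hxd⟩ := hv2 E hE hFE hEF z hzP hzF hφz
      have hxM : x ∈ M := (hmemM x).2 hxd
      refine ⟨E ∩ M, qp_face_slice hE _, ?_⟩
      have hne : E ∩ (M : Set (Fin d → ℝ)) ≠ ∅ := Set.Nonempty.ne_empty ⟨x, hxr.1, hxM⟩
      simp only [hΨ, if_neg hne]
      apply Set.Subset.antisymm
      · exact Set.sInter_subset_of_mem ⟨hE, Set.inter_subset_left⟩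
      · apply Set.subset_sInter
        rintro E' ⟨hE', hGE'⟩
        exact qp_face_of_ri hE' (qp_face_subset hE) hxr (hGE' ⟨hxr.1, hxM⟩)
  · intro G₁ h₁ G₂ h₂
    change G₁ ⊆ G₂ ↔ Ψ G₁ ⊆ Ψ G₂
    constructor
    · intro h
      by_cases h1 : G₁ = ∅
      · have : Ψ G₁ = F := by simp only [hΨ, if_pos h1]
        rw [this]
        exact (hmaps G₂ h₂).2
      · have h2 : G₂ ≠ ∅ := fun h2 => h1 (Set.subset_empty_iff.1 (h2 ▸ h))
        simp only [hΨ, if_neg h1, if_neg h2]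
        exact Set.sInter_subset_sInter fun E hE => ⟨hE.1, h.trans hE.2⟩
    · intro h
      rw [hrec G₁ h₁, hrec G₂ h₂]
      exact Set.inter_subset_inter_left _ h

end
end
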